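/- arXiv:0809.1620 — 4 statements merged into one kernel-verified Lean document; each statement's English description precedes it below -/
import Mathlib

section
/- Every Delzant polygon in ℝ² with exactly three edges is AGL(2,ℤ)-congruent to the standard Delzant triangle Δ_λ = {(x₁,x₂) ∈ ℝ² : x₁ ≥ 0, x₂ ≥ 0, x₁ + x₂ ≤ λ} for a unique real number λ > 0. -/
open Set Finset MeasureTheory

/-- Points of ℝⁿ. -/
abbrev Pt (n : ℕ) := Fin n → ℝ

/-- A convex polytope in ℝⁿ: a compact convex set with nonempty interior and
finitely many extreme points. -/
def IsConvexPolytope {n : ℕ} (Δ : Set (Pt n)) : Prop :=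
  IsCompact Δ ∧ Convex ℝ Δ ∧ (interior Δ).Nonempty ∧ (Set.extremePoints ℝ Δ).Finite

/-- An edge (one-dimensional face) of a polytope: a nondegenerate closed segment
that is an extreme subset of the polytope. -/
def IsEdge {n : ℕ} (Δ e : Set (Pt n)) : Prop :=
  (∃ a b : Pt n, a ≠ b ∧ e = segment ℝ a b) ∧ IsExtreme ℝ Δ e

/-- A family of vectors of ℝⁿ forming a basis of the lattice ℤⁿ. -/
def IsLatticeBasis {n : ℕ} (α : Fin n → Pt n) : Prop :=
  ∃ A : Matrix (Fin n) (Fin n) ℤ, IsUnit A.det ∧ ∀ j i, α j i = (A j i : ℝ)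

/-- The Delzant condition at the vertex `v`: the edges emanating from `v` have the
form `{v + s • α j : 0 ≤ s ≤ ℓ j}` where the `α j` form a basis of the lattice ℤⁿ. -/
def DelzantAt {n : ℕ} (Δ : Set (Pt n)) (v : Pt n) : Prop :=
  ∃ (α : Fin n → Pt n) (ℓ : Fin n → ℝ), IsLatticeBasis α ∧ (∀ j, 0 < ℓ j) ∧
    {e | IsEdge Δ e ∧ v ∈ e} = {e | ∃ j, e = segment ℝ v (v + ℓ j • α j)}

/-- A Delzant polytope in ℝⁿ. -/
def IsDelzant {n : ℕ} (Δ : Set (Pt n)) : Prop :=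
  IsConvexPolytope Δ ∧ ∀ v ∈ Set.extremePoints ℝ Δ, DelzantAt Δ v

/-- `Δ'` is obtained from `Δ` by a corner chopping of size `δ` at the vertex `v`. -/
def IsCornerChop {n : ℕ} (Δ : Set (Pt n)) (v : Pt n) (δ : ℝ) (Δ' : Set (Pt n)) : Prop :=
  v ∈ Set.extremePoints ℝ Δ ∧ 0 < δ ∧
  ∃ (α : Fin n → Pt n) (ℓ : Fin n → ℝ), IsLatticeBasis α ∧ (∀ j, δ < ℓ j) ∧
    {e | IsEdge Δ e ∧ v ∈ e} = {e | ∃ j, e = segment ℝ v (v + ℓ j • α j)} ∧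
    Δ' = Δ ∩ {x | ∃ s : Fin n → ℝ, x = v + ∑ j, s j • α j ∧ δ ≤ ∑ j, s j}

/-- An element of AGL(n,ℤ): an affine map `x ↦ A x + c` with `A ∈ GL(n,ℤ)`. -/
def IsAGL {n : ℕ} (g : Pt n → Pt n) : Prop :=
  ∃ (A : Matrix (Fin n) (Fin n) ℤ) (c : Pt n), IsUnit A.det ∧
    ∀ x, g x = (A.map (fun z : ℤ => (z : ℝ))).mulVec x + c

/-- Two subsets of ℝⁿ are AGL(n,ℤ)-congruent. -/
def AGLCongruent {n : ℕ} (S T : Set (Pt n)) : Prop :=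
  ∃ g : Pt n → Pt n, IsAGL g ∧ g '' S = T

/-- A primitive vector of ℤⁿ: nonzero and not a multiple `m • w` with `m ≥ 2`. -/
def IsPrimitive {n : ℕ} (v : Fin n → ℤ) : Prop :=
  v ≠ 0 ∧ ∀ m : ℕ, 2 ≤ m → ∀ w : Fin n → ℤ, v ≠ (m : ℤ) • w

/-- `d` is a segment of rational slope and rational length `ℓ`: its endpoints differ
by `ℓ • v` with `v` a primitive vector of ℤⁿ. -/
def RatLength {n : ℕ} (d : Set (Pt n)) (ℓ : ℝ) : Prop :=
  0 < ℓ ∧ ∃ (a : Pt n) (v : Fin n → ℤ), IsPrimitive v ∧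
    d = segment ℝ a (a + ℓ • fun i => (v i : ℝ))

/-- `P` is the (rational) perimeter of the polygon `Δ`: the sum of the rational
lengths of its edges. -/
def HasPerimeter (Δ : Set (Pt 2)) (P : ℝ) : Prop :=
  ∃ (E : Finset (Set (Pt 2))) (len : Set (Pt 2) → ℝ),
    (↑E = {e | IsEdge Δ e}) ∧ (∀ e ∈ E, RatLength e (len e)) ∧ P = ∑ e ∈ E, len e

/-- The Delzant triangle of size `lam`. -/
def DelzantTriangle (lam : ℝ) : Set (Pt 2) :=
  {x | 0 ≤ x 0 ∧ 0 ≤ x 1 ∧ x 0 + x 1 ≤ lam}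

/-- The Hirzebruch trapezoid with parameters `a`, `b`, `k`. -/
def Hirz (a b : ℝ) (k : ℕ) : Set (Pt 2) :=
  {x | -(b/2) ≤ x 1 ∧ x 1 ≤ b/2 ∧ 0 ≤ x 0 ∧ x 0 ≤ a - k * x 1}

theorem left_mem_extremePoints_segment {E : Type*} [AddCommGroup E] [Module ℝ E] (a b : E) :
    a ∈ Set.extremePoints ℝ (segment ℝ a b) := by
  refine mem_extremePoints_iff_left.2 ⟨left_mem_segment ℝ a b, ?_⟩
  rw [segment_eq_image']
  rintro _ ⟨s, hs, rfl⟩ _ ⟨t, ht, rfl⟩ ⟨μ, ν, hμ, hν, hμν, h⟩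
  rcases eq_or_ne a b with rfl | hab
  · simp
  have h0 : (μ * s + ν * t) • (b - a) = 0 := by
    have h' : (μ + ν) • a + (μ * s + ν * t) • (b - a) = a := by
      rw [add_smul, add_smul, mul_smul, mul_smul]
      refine Eq.trans ?_ h
      dsimp only
      module
    rw [hμν, one_smul] at h'
    exact left_eq_add.mp h'.symm
  have h1 : μ * s + ν * t = 0 :=
    (smul_eq_zero.1 h0).resolve_right (sub_ne_zero.2 hab.symm)
  have h2 : μ * s = 0 := by
    nlinarith [mul_nonneg hμ.le hs.1, mul_nonneg hν.le ht.1]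
  have h3 : s = 0 := (mul_eq_zero.1 h2).resolve_left hμ.ne'
  simp [h3]

theorem extremePoints_segment {E : Type*} [AddCommGroup E] [Module ℝ E] (a b : E) :
    Set.extremePoints ℝ (segment ℝ a b) = {a, b} := by
  apply Set.Subset.antisymm
  · rw [← convexHull_pair]
    exact extremePoints_convexHull_subset
  · rintro x (rfl | rfl)
    · exact left_mem_extremePoints_segment x b
    · rw [segment_symm]
      exact left_mem_extremePoints_segment x a

theorem segment_right_injective {E : Type*} [AddCommGroup E] [Module ℝ E] {v p q : E}
    (h : segment ℝ v p = segment ℝ v q) : p = q := by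
  have h' : ({v, p} : Set E) = {v, q} := by
    rw [← extremePoints_segment, ← extremePoints_segment, h]
  have hp : p ∈ ({v, q} : Set E) := h' ▸ (by simp)
  have hq : q ∈ ({v, p} : Set E) := h' ▸ (by simp)
  simp only [Set.mem_insert_iff, Set.mem_singleton_iff] at hp hq
  grind

theorem mem_convexHull_triple_iff {E : Type*} [AddCommGroup E] [Module ℝ E] {v p q x : E} :
    x ∈ convexHull ℝ {v, p, q} ↔
      ∃ s t : ℝ, 0 ≤ s ∧ 0 ≤ t ∧ s + t ≤ 1 ∧ x = v + s • (p - v) + t • (q - v) := by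
  constructor
  · rw [convexHull_insert (Set.insert_nonempty _ _), convexHull_pair]
    simp only [mem_convexJoin, Set.mem_singleton_iff, exists_eq_left]
    rintro ⟨y, ⟨α, β, hα, hβ, hαβ, rfl⟩, γ, δ, hγ, hδ, hγδ, rfl⟩
    refine ⟨δ * α, δ * β, by positivity, by positivity, ?_, ?_⟩
    · rw [← mul_add, hαβ]; linarith
    · obtain rfl : γ = 1 - δ := by linarith
      obtain rfl : α = 1 - β := by linarith
      module
  · rintro ⟨s, t, hs, ht, hst, rfl⟩
    have h := (convex_convexHull ℝ {v, p, q}).sum_mem (t := Finset.univ)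
      (w := ![1 - s - t, s, t]) (z := ![v, p, q])
      (by intro i _; fin_cases i <;> simp <;> linarith)
      (by simp only [Fin.sum_univ_three, Matrix.cons_val]; ring)
      (by intro i _; apply subset_convexHull; fin_cases i <;> simp)
    convert h using 1
    simp only [Fin.sum_univ_three, Matrix.cons_val]
    module

/-- The corner at `v` with neighbours `p` and `q` is spanned by a lattice basis, with respect to
which the sides `[v, p]` and `[v, q]` have lengths `a` and `b`. -/
def UnimodularCorner (v p q : Pt 2) (a b : ℝ) : Prop :=
  0 < a ∧ 0 < b ∧ ∃ u w : Fin 2 → ℤ, IsUnit (u 0 * w 1 - u 1 * w 0) ∧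
    (∀ i, p i = v i + a * u i) ∧ ∀ i, q i = v i + b * w i

theorem UnimodularCorner.symm {v p q : Pt 2} {a b : ℝ} (h : UnimodularCorner v p q a b) :
    UnimodularCorner v q p b a := by
  obtain ⟨ha, hb, u, w, hd, hp, hq⟩ := h
  refine ⟨hb, ha, w, u, ?_, hq, hp⟩
  rw [← IsUnit.neg_iff]
  convert hd using 1
  ring

theorem le_of_mul_unimodular_eq {u w u' : Fin 2 → ℤ} {a c : ℝ} (ha : 0 < a) (hc : 0 < c)
    (hd : IsUnit (u 0 * w 1 - u 1 * w 0)) (h : ∀ i, a * u i = c * u' i) : c ≤ a := by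
  obtain ⟨k, hk⟩ : ∃ k : ℤ, a = c * k := by
    have e : a * ((u 0 * w 1 - u 1 * w 0 : ℤ) : ℝ) = c * ((u' 0 * w 1 - u' 1 * w 0 : ℤ) : ℝ) := by
      push_cast
      linear_combination (w 1 : ℝ) * h 0 - (w 0 : ℝ) * h 1
    rcases Int.isUnit_iff.1 hd with h1 | h1 <;> rw [h1] at e
    · exact ⟨u' 0 * w 1 - u' 1 * w 0, by simpa using e⟩
    · refine ⟨-(u' 0 * w 1 - u' 1 * w 0), ?_⟩
      push_cast at e ⊢
      linarith
  have hk0 : (0 : ℝ) < k := pos_of_mul_pos_right (hk ▸ ha) hc.le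
  have hk1 : (1 : ℝ) ≤ k := by exact_mod_cast hk0
  nlinarith

/-- The length of a side does not depend on the end from which it is measured. -/
theorem UnimodularCorner.length_eq {v p q r : Pt 2} {a b c d : ℝ}
    (h : UnimodularCorner v p q a b) (h' : UnimodularCorner p v r c d) : a = c := by
  obtain ⟨ha, -, u, w, hd, hp, -⟩ := h
  obtain ⟨hc, -, u', w', hd', hp', -⟩ := h'
  refine le_antisymm (le_of_mul_unimodular_eq (u := u') (u' := fun i => -u i) hc ha hd' ?_)
    (le_of_mul_unimodular_eq (u := u) (u' := fun i => -u' i) ha hc hd ?_) <;>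
  · intro i
    push_cast
    linarith [hp i, hp' i]

theorem UnimodularCorner.mul_eq {v p q : Pt 2} {a b c d : ℝ}
    (h : UnimodularCorner v p q a b) (h' : UnimodularCorner p v q c d) : a * b = c * d := by
  obtain ⟨ha, hb, u, w, hd, hp, hq⟩ := h
  obtain ⟨hc, hd0, u', w', hd', hp', hq'⟩ := h'
  have e : a * b * ((u 0 * w 1 - u 1 * w 0 : ℤ) : ℝ) =
      - (c * d * ((u' 0 * w' 1 - u' 1 * w' 0 : ℤ) : ℝ)) := by
    have e1 : ∀ i, a * u i = p i - v i := fun i => by linarith [hp i]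
    have e2 : ∀ i, b * w i = q i - v i := fun i => by linarith [hq i]
    have e3 : ∀ i, c * u' i = v i - p i := fun i => by linarith [hp' i]
    have e4 : ∀ i, d * w' i = q i - p i := fun i => by linarith [hq' i]
    calc _ = (a * u 0) * (b * w 1) - (a * u 1) * (b * w 0) := by push_cast; ring
      _ = -((c * u' 0) * (d * w' 1) - (c * u' 1) * (d * w' 0)) := by
        rw [e1, e1, e2, e2, e3, e3, e4, e4]; ring
      _ = _ := by push_cast; ring
  have h1 := mul_pos ha hb
  have h2 := mul_pos hc hd0
  rcases Int.isUnit_iff.1 hd with h3 | h3 <;> rcases Int.isUnit_iff.1 hd' with h4 | h4 <;>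
    rw [h3, h4] at e <;> push_cast at e <;> linarith

/-- A triangle whose three corners are unimodular has sides of equal length. -/
theorem UnimodularCorner.side_eq {v p q : Pt 2} {a b c d e f : ℝ}
    (hv : UnimodularCorner v p q a b) (hp : UnimodularCorner p v q c d)
    (hq : UnimodularCorner q v p e f) : a = b := by
  have h1 : a = c := hv.length_eq hp
  have h2 : b = e := hv.symm.length_eq hq
  have h3 : d = f := hp.symm.length_eq hq.symm
  have h4 : a * b = c * d := hv.mul_eq hp
  have h5 : b * a = e * f := hv.symm.mul_eq hq
  subst h1 h2 h3
  have h6 : b = d := mul_left_cancel₀ hv.1.ne' h4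
  have h7 : a = d := mul_left_cancel₀ hv.2.1.ne' h5
  rw [h6, h7]

theorem UnimodularCorner.aglCongruent {v p q : Pt 2} {a : ℝ} (h : UnimodularCorner v p q a a) :
    AGLCongruent (convexHull ℝ {v, p, q}) (DelzantTriangle a) := by
  obtain ⟨ha, -, u, w, hd, hp, hq⟩ := h
  obtain ⟨D, hD⟩ : ∃ D, D = u 0 * w 1 - u 1 * w 0 := ⟨_, rfl⟩
  have hDD : D * D = 1 := Int.isUnit_mul_self (hD ▸ hd)
  have hDD' : (D : ℝ) * D = 1 := by exact_mod_cast hDD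
  have hD' : (D : ℝ) = u 0 * w 1 - u 1 * w 0 := by exact_mod_cast hD
  let A : Matrix (Fin 2) (Fin 2) ℤ := !![D * w 1, -(D * w 0); -(D * u 1), D * u 0]
  have hA0 : ∀ x : Pt 2, (A.map (fun z : ℤ => (z : ℝ))).mulVec x 0 =
      D * (w 1 * x 0 - w 0 * x 1) := fun x => by
    simp [A, Matrix.mulVec, dotProduct, Fin.sum_univ_two]; ring
  have hA1 : ∀ x : Pt 2, (A.map (fun z : ℤ => (z : ℝ))).mulVec x 1 =
      D * (u 0 * x 1 - u 1 * x 0) := fun x => by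
    simp [A, Matrix.mulVec, dotProduct, Fin.sum_univ_two]; ring
  have hg : ∀ s t : ℝ, ∀ x : Pt 2, x = v + s • (p - v) + t • (q - v) →
      ((A.map (fun z : ℤ => (z : ℝ))).mulVec x +
        -(A.map (fun z : ℤ => (z : ℝ))).mulVec v) = ![a * s, a * t] := by
    rintro s t x rfl
    have e0 := hp 0
    have e1 := hp 1
    have e2 := hq 0
    have e3 := hq 1
    ext i
    fin_cases i
    · simp only [Fin.zero_eta, Pi.add_apply, Pi.neg_apply, hA0, Pi.smul_apply, Pi.sub_apply,
        smul_eq_mul, e0, e1, e2, e3, Matrix.cons_val_zero]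
      linear_combination (-(a * s * D)) * hD' + a * s * hDD'
    · simp only [Fin.mk_one, Pi.add_apply, Pi.neg_apply, hA1, Pi.smul_apply, Pi.sub_apply,
        smul_eq_mul, e0, e1, e2, e3, Matrix.cons_val_one, Matrix.cons_val_zero]
      linear_combination (-(a * t * D)) * hD' + a * t * hDD'
  refine ⟨_, ⟨A, -(A.map (fun z : ℤ => (z : ℝ))).mulVec v, ?_, fun x => rfl⟩, ?_⟩
  · have : A.det = D := by
      rw [Matrix.det_fin_two]
      simp only [A, Matrix.of_apply, Matrix.cons_val]
      linear_combination (-(D * D)) * hD + D * hDD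
    rw [this, hD]
    exact hd
  · ext y
    constructor
    · rintro ⟨x, hx, rfl⟩
      obtain ⟨s, t, hs, ht, hst, hx⟩ := mem_convexHull_triple_iff.1 hx
      simp only [hg s t x hx, DelzantTriangle, Set.mem_ofPred_eq, Matrix.cons_val_zero,
        Matrix.cons_val_one]
      exact ⟨by positivity, by positivity, by nlinarith⟩
    · rintro ⟨h0, h1, h2⟩
      refine ⟨v + (y 0 / a) • (p - v) + (y 1 / a) • (q - v), mem_convexHull_triple_iff.2
        ⟨_, _, by positivity, by positivity, ?_, rfl⟩, ?_⟩
      · rw [← add_div]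
        exact div_le_one_of_le₀ h2 ha.le
      · dsimp only
        rw [hg _ _ _ rfl]
        ext i
        fin_cases i <;> simp <;> field_simp

theorem AGLCongruent.volume_eq {S T : Set (Pt 2)} (h : AGLCongruent S T) :
    volume T = volume S := by
  obtain ⟨g, ⟨A, c, hA, hg⟩, rfl⟩ := h
  have e : g '' S = (fun x => x + c) ''
      (Matrix.toLin' (A.map (fun z : ℤ => (z : ℝ))) '' S) := by
    rw [Set.image_image]
    exact Set.image_congr fun x _ => by rw [hg, Matrix.toLin'_apply]
  have hdet : (A.map (fun z : ℤ => (z : ℝ))).det = (A.det : ℝ) :=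
    ((Int.castRingHom ℝ).map_det A).symm
  rw [e, Set.image_add_right, measure_preimage_add_right, Measure.addHaar_image_linearMap,
    LinearMap.det_toLin', hdet]
  rcases Int.isUnit_iff.1 hA with h1 | h1 <;> simp [h1]

open scoped Pointwise in
theorem delzantTriangle_eq_smul {a : ℝ} (ha : 0 < a) :
    DelzantTriangle a = a • DelzantTriangle 1 := by
  ext x
  rw [Set.mem_smul_set_iff_inv_smul_mem₀ ha.ne']
  simp only [DelzantTriangle, Set.mem_ofPred_eq, Pi.smul_apply, smul_eq_mul, ← mul_add]
  rw [inv_mul_le_iff₀ ha, mul_one, mul_nonneg_iff_of_pos_left (inv_pos.2 ha),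
    mul_nonneg_iff_of_pos_left (inv_pos.2 ha)]

theorem volume_delzantTriangle_one_ne_top : volume (DelzantTriangle 1) ≠ ⊤ := by
  have h : DelzantTriangle 1 ⊆ Set.Icc 0 1 := by
    rintro x ⟨h0, h1, h2⟩
    refine ⟨fun i => ?_, fun i => ?_⟩ <;> fin_cases i <;> simp <;> linarith
  exact ((measure_mono h).trans_lt isCompact_Icc.measure_lt_top).ne

theorem volume_delzantTriangle_one_ne_zero : volume (DelzantTriangle 1) ≠ 0 := by
  have h : Set.Icc (0 : Pt 2) (fun _ => 1 / 2) ⊆ DelzantTriangle 1 := by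
    rintro x ⟨h0, h1⟩
    have a0 := h0 0
    have a1 := h0 1
    have b0 := h1 0
    have b1 := h1 1
    simp only [Pi.zero_apply] at a0 a1
    exact ⟨a0, a1, by linarith⟩
  intro h0
  have := measure_mono_null h h0
  rw [Real.volume_Icc_pi] at this
  simp at this

open scoped Pointwise in
theorem delzantTriangle_volume_injective {a b : ℝ} (ha : 0 < a) (hb : 0 < b)
    (h : volume (DelzantTriangle a) = volume (DelzantTriangle b)) : a = b := by
  rw [delzantTriangle_eq_smul ha, delzantTriangle_eq_smul hb, Measure.addHaar_smul,
    Measure.addHaar_smul, ENNReal.mul_left_inj volume_delzantTriangle_one_ne_zero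
      volume_delzantTriangle_one_ne_top, ENNReal.ofReal_eq_ofReal_iff (by positivity)
      (by positivity), abs_of_nonneg (by positivity), abs_of_nonneg (by positivity)] at h
  simp only [Module.finrank_fin_fun] at h
  exact (pow_left_inj₀ ha.le hb.le two_ne_zero).1 h

theorem DelzantAt.exists_unimodularCorner {Δ : Set (Pt 2)} {v : Pt 2} (h : DelzantAt Δ v) :
    ∃ p q a b, UnimodularCorner v p q a b ∧
      {e | IsEdge Δ e ∧ v ∈ e} = {segment ℝ v p, segment ℝ v q} := by
  obtain ⟨α, ℓ, ⟨A, hA, hα⟩, hℓ, h⟩ := h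
  refine ⟨v + ℓ 0 • α 0, v + ℓ 1 • α 1, ℓ 0, ℓ 1, ⟨hℓ 0, hℓ 1, A 0, A 1, ?_, ?_, ?_⟩, ?_⟩
  · rwa [Matrix.det_fin_two] at hA
  · intro i; simp [hα]
  · intro i; simp [hα]
  · rw [h]
    ext e
    simp [Fin.exists_fin_two]

theorem UnimodularCorner.ne {v p q : Pt 2} {a b : ℝ} (h : UnimodularCorner v p q a b) :
    v ≠ p ∧ v ≠ q ∧ p ≠ q := by
  obtain ⟨ha, hb, u, w, hd, hp, hq⟩ := h
  have hd0 := hd.ne_zero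
  refine ⟨?_, ?_, ?_⟩ <;> rintro rfl
  · have : ∀ i, u i = 0 := fun i => by simpa [ha.ne'] using hp i
    simp [this] at hd0
  · have : ∀ i, w i = 0 := fun i => by simpa [hb.ne'] using hq i
    simp [this] at hd0
  · have e : ∀ i, a * u i = b * w i := fun i => by linarith [hp i, hq i]
    have : a * ((u 0 * w 1 - u 1 * w 0 : ℤ) : ℝ) = 0 := by
      push_cast
      linear_combination (w 1 : ℝ) * e 0 - (w 0 : ℝ) * e 1
    rcases mul_eq_zero.1 this with h | h
    · exact ha.ne' h
    · exact hd0 (by exact_mod_cast h)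

/-- The Delzant condition at a vertex whose edges are known. -/
theorem DelzantAt.unimodularCorner {Δ : Set (Pt 2)} {v p q : Pt 2} (h : DelzantAt Δ v)
    (he : {e | IsEdge Δ e ∧ v ∈ e} = {segment ℝ v p, segment ℝ v q}) :
    ∃ a b, UnimodularCorner v p q a b := by
  obtain ⟨p', q', a, b, hc, he'⟩ := h.exists_unimodularCorner
  rw [he', Set.pair_eq_pair_iff] at he
  rcases he with ⟨h1, h2⟩ | ⟨h1, h2⟩ <;>
    rw [segment_right_injective h1, segment_right_injective h2] at hc
  · exact ⟨a, b, hc⟩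
  · exact ⟨b, a, hc.symm⟩

theorem IsEdge.left_mem_extremePoints {Δ : Set (Pt 2)} {a b : Pt 2}
    (h : IsEdge Δ (segment ℝ a b)) : a ∈ Set.extremePoints ℝ Δ :=
  h.2.extremePoints_subset_extremePoints (left_mem_extremePoints_segment a b)

theorem IsEdge.eq_or_eq_of_mem_extremePoints {Δ : Set (Pt 2)} {a b x : Pt 2}
    (h : IsEdge Δ (segment ℝ a b)) (hx : x ∈ Set.extremePoints ℝ Δ) (hxe : x ∈ segment ℝ a b) :
    x = a ∨ x = b := by
  have : x ∈ Set.extremePoints ℝ (segment ℝ a b) := h.2.extremePoints_eq ▸ ⟨hxe, hx⟩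
  simpa [extremePoints_segment] using this

theorem IsEdge.eq_segment {Δ e : Set (Pt 2)} {x y : Pt 2} (h : IsEdge Δ e) (hxy : x ≠ y)
    (hx : x ∈ Set.extremePoints ℝ Δ) (hxe : x ∈ e)
    (hy : y ∈ Set.extremePoints ℝ Δ) (hye : y ∈ e) : e = segment ℝ x y := by
  obtain ⟨a, b, -, rfl⟩ := h.1
  rcases h.eq_or_eq_of_mem_extremePoints hx hxe with rfl | rfl <;>
    rcases h.eq_or_eq_of_mem_extremePoints hy hye with rfl | rfl
  · exact absurd rfl hxy
  · rfl
  · exact segment_symm ℝ _ _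
  · exact absurd rfl hxy

/-- Every edge at a vertex of a Delzant polygon has a companion at that vertex. -/
theorem DelzantAt.exists_ne {Δ e : Set (Pt 2)} {v : Pt 2} (h : DelzantAt Δ v) :
    ∃ f, IsEdge Δ f ∧ v ∈ f ∧ f ≠ e := by
  obtain ⟨p, q, a, b, hc, he⟩ := h.exists_unimodularCorner
  have hp : IsEdge Δ (segment ℝ v p) ∧ v ∈ segment ℝ v p := he.symm.subset (Or.inl rfl)
  have hq : IsEdge Δ (segment ℝ v q) ∧ v ∈ segment ℝ v q := he.symm.subset (Or.inr rfl)
  by_cases h1 : segment ℝ v p = e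
  · exact ⟨_, hq.1, hq.2, fun h2 => hc.ne.2.2 (segment_right_injective (h1.trans h2.symm))⟩
  · exact ⟨_, hp.1, hp.2, h1⟩

/-- A Delzant polygon with three edges is a triangle with unimodular corners. -/
theorem IsDelzant.exists_triangle {Δ : Set (Pt 2)} (hΔ : IsDelzant Δ)
    (h3 : {e | IsEdge Δ e}.ncard = 3) :
    ∃ v p q a b c d e f, Δ = convexHull ℝ {v, p, q} ∧ UnimodularCorner v p q a b ∧
      UnimodularCorner p v q c d ∧ UnimodularCorner q v p e f := by
  obtain ⟨⟨hcomp, hconv, hint, hfin⟩, hD⟩ := hΔ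
  obtain ⟨v, hv⟩ := hcomp.extremePoints_nonempty (hint.mono interior_subset)
  obtain ⟨p, q, a, b, hc, he⟩ := (hD v hv).exists_unimodularCorner
  obtain ⟨hvp, hvq, hpq⟩ := hc.ne
  have h1 : IsEdge Δ (segment ℝ v p) := (he.symm.subset (Or.inl rfl)).1
  have h2 : IsEdge Δ (segment ℝ v q) := (he.symm.subset (Or.inr rfl)).1
  have hp : p ∈ Set.extremePoints ℝ Δ :=
    IsEdge.left_mem_extremePoints (b := v) (by rwa [segment_symm])
  have hq : q ∈ Set.extremePoints ℝ Δ :=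
    IsEdge.left_mem_extremePoints (b := v) (by rwa [segment_symm])
  have hp2 : p ∉ segment ℝ v q := fun h =>
    (h2.eq_or_eq_of_mem_extremePoints hp h).elim hvp.symm hpq
  have hq1 : q ∉ segment ℝ v p := fun h =>
    (h1.eq_or_eq_of_mem_extremePoints hq h).elim hvq.symm hpq.symm
  have h12 : segment ℝ v p ≠ segment ℝ v q := fun h => hpq (segment_right_injective h)
  obtain ⟨F, hF, hpF, hF1⟩ := (hD p hp).exists_ne (e := segment ℝ v p)
  obtain ⟨G, hG, hqG, hG2⟩ := (hD q hq).exists_ne (e := segment ℝ v q)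
  have hF2 : F ≠ segment ℝ v q := fun h => hp2 (h ▸ hpF)
  have hG1 : G ≠ segment ℝ v p := fun h => hq1 (h ▸ hqG)
  have hS : {e | IsEdge Δ e} = {segment ℝ v p, segment ℝ v q, F} := by
    refine (Set.eq_of_subset_of_ncard_le ?_ ?_ (Set.finite_of_ncard_ne_zero (by omega))).symm
    · rintro e (rfl | rfl | rfl) <;> assumption
    · rw [h3, Set.ncard_eq_three.2 ⟨_, _, _, h12, hF1.symm, hF2.symm, rfl⟩]
  have hGF : G = F := by
    have : G ∈ ({segment ℝ v p, segment ℝ v q, F} : Set (Set (Pt 2))) := hS.subset hG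
    simpa [hG1, hG2] using this
  subst hGF
  obtain rfl : G = segment ℝ p q := hF.eq_segment hpq hp hpF hq hqG
  have hedge : ∀ e, IsEdge Δ e ↔ e = segment ℝ v p ∨ e = segment ℝ v q ∨ e = segment ℝ p q :=
    fun e => Set.ext_iff.1 hS e
  have hep : {e | IsEdge Δ e ∧ p ∈ e} = {segment ℝ p v, segment ℝ p q} := by
    ext e
    simp only [Set.mem_ofPred_eq, hedge, Set.mem_insert_iff, Set.mem_singleton_iff,
      segment_symm ℝ p v]
    constructor
    · rintro ⟨rfl | rfl | rfl, h⟩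
      exacts [Or.inl rfl, absurd h hp2, Or.inr rfl]
    · rintro (rfl | rfl)
      exacts [⟨Or.inl rfl, right_mem_segment ℝ _ _⟩, ⟨Or.inr (Or.inr rfl), hpF⟩]
  have heq : {e | IsEdge Δ e ∧ q ∈ e} = {segment ℝ q v, segment ℝ q p} := by
    ext e
    simp only [Set.mem_ofPred_eq, hedge, Set.mem_insert_iff, Set.mem_singleton_iff,
      segment_symm ℝ q v, segment_symm ℝ q p]
    constructor
    · rintro ⟨rfl | rfl | rfl, h⟩
      exacts [absurd h hq1, Or.inl rfl, Or.inr rfl]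
    · rintro (rfl | rfl)
      exacts [⟨Or.inr (Or.inl rfl), right_mem_segment ℝ _ _⟩, ⟨Or.inr (Or.inr rfl), hqG⟩]
  obtain ⟨c, d, hcp⟩ := (hD p hp).unimodularCorner hep
  obtain ⟨e, f, hcq⟩ := (hD q hq).unimodularCorner heq
  have hext : Set.extremePoints ℝ Δ = {v, p, q} := by
    apply Set.Subset.antisymm
    · intro r hr
      obtain ⟨E, hE, hrE, -⟩ := (hD r hr).exists_ne (e := ∅)
      have hE' := hE
      simp only [Set.mem_insert_iff, Set.mem_singleton_iff]
      rcases (hedge E).1 hE with rfl | rfl | rfl <;>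
        rcases hE'.eq_or_eq_of_mem_extremePoints hr hrE with h | h <;> simp [h]
    · rintro r (rfl | rfl | rfl) <;> assumption
  refine ⟨v, p, q, a, b, c, d, e, f, ?_, hc, hcp, hcq⟩
  rw [← closure_convexHull_extremePoints hcomp hconv, hext]
  exact ((Set.toFinite {v, p, q}).isCompact_convexHull (𝕜 := ℝ)).isClosed.closure_eq

/-- Every Delzant polygon in ℝ² with exactly three edges is AGL(2,ℤ)-congruent to the
standard Delzant triangle `Δ_λ` for a unique `λ > 0`. -/
theorem stmt0 (Δ : Set (Pt 2)) (hΔ : IsDelzant Δ)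
    (h3 : {e | IsEdge Δ e}.ncard = 3) :
    ∃! lam : ℝ, 0 < lam ∧ AGLCongruent Δ (DelzantTriangle lam) := by
  obtain ⟨v, p, q, a, b, c, d, e, f, rfl, hv, hp, hq⟩ := hΔ.exists_triangle h3
  obtain rfl : a = b := hv.side_eq hp hq
  refine ⟨a, ⟨hv.1, hv.aglCongruent⟩, ?_⟩
  rintro lam ⟨hlam, h⟩
  exact delzantTriangle_volume_injective hlam hv.1
    (h.volume_eq.trans hv.aglCongruent.volume_eq.symm)
end

section
/- Let Δ₀, Δ₁, …, Δ_s be a sequence of Delzant polygons in ℝ² such that, for each i, the polygon Δᵢ is obtained from Δᵢ₋₁ by a corner chopping of size δᵢ > 0. Then perimeter(Δ_s) = perimeter(Δ₀) − δ₁ − … − δ_s, where the perimeter of a polygon denotes the sum of the rational lengths of its edges. -/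
open Set Finset MeasureTheory

lemma mem_segment_iff_add_smul {a b x : Pt 2} :
    x ∈ segment ℝ a b ↔ ∃ t : ℝ, 0 ≤ t ∧ t ≤ 1 ∧ x = a + t • (b - a) := by
  rw [segment_eq_image']
  constructor
  · rintro ⟨t, ⟨h0, h1⟩, rfl⟩
    exact ⟨t, h0, h1, rfl⟩
  · rintro ⟨t, h0, h1, rfl⟩
    exact ⟨t, ⟨h0, h1⟩, rfl⟩

lemma mem_openSegment_of_add_smul {x y : Pt 2} {t : ℝ} (h0 : 0 < t) (h1 : t < 1) :
    x + t • (y - x) ∈ openSegment ℝ x y := by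
  rw [openSegment_eq_image']
  exact ⟨t, ⟨h0, h1⟩, rfl⟩

/-- The endpoint differences of two descriptions of a segment agree up to sign. -/
lemma sub_eq_or_eq_neg_of_segment_eq {a b c d : Pt 2} (hab : a ≠ b)
    (h : segment ℝ a b = segment ℝ c d) : b - a = d - c ∨ b - a = -(d - c) := by
  obtain ⟨s, hs0, hs1, hs⟩ := mem_segment_iff_add_smul.1 (h ▸ left_mem_segment ℝ a b)
  obtain ⟨t, ht0, ht1, ht⟩ := mem_segment_iff_add_smul.1 (h ▸ right_mem_segment ℝ a b)
  obtain ⟨s', hs0', hs1', hs'⟩ := mem_segment_iff_add_smul.1 (h.symm ▸ left_mem_segment ℝ c d)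
  obtain ⟨t', ht0', ht1', ht'⟩ := mem_segment_iff_add_smul.1 (h.symm ▸ right_mem_segment ℝ c d)
  have h1 : b - a = (t - s) • (d - c) := by rw [hs, ht]; module
  have h2 : d - c = (t' - s') • (b - a) := by rw [hs', ht']; module
  have h3 : ((t - s) * (t' - s') - 1) • (b - a) = 0 := by
    rw [sub_smul, mul_smul, ← h2, ← h1]; module
  have h4 : (t - s) * (t' - s') = 1 := by
    rcases smul_eq_zero.1 h3 with h | h
    · linarith
    · exact absurd (sub_eq_zero.1 h).symm hab
  have h5 : t - s = 1 ∨ t - s = -1 := by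
    rcases le_total 0 (t - s) with h | h
    · left; nlinarith
    · right; nlinarith
  rcases h5 with h5 | h5
  · left; rw [h1, h5, one_smul]
  · right; rw [h1, h5, neg_one_smul]

lemma IsPrimitive.isCoprime {v : Fin 2 → ℤ} (hv : IsPrimitive v) : IsCoprime (v 0) (v 1) := by
  rw [Int.isCoprime_iff_gcd_eq_one]
  by_contra hg
  have h0 : Int.gcd (v 0) (v 1) ≠ 0 := by
    intro h
    rw [Int.gcd_eq_zero_iff] at h
    exact hv.1 (funext fun i => by fin_cases i <;> simp [h.1, h.2])
  obtain ⟨p, hp⟩ := Int.gcd_dvd_left (v 0) (v 1)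
  obtain ⟨q, hq⟩ := Int.gcd_dvd_right (v 0) (v 1)
  refine hv.2 (Int.gcd (v 0) (v 1)) (by omega) ![p, q] (funext fun i => ?_)
  fin_cases i
  · simpa using hp
  · simpa using hq

lemma isPrimitive_of_det {v w : Fin 2 → ℤ} (h : IsUnit (v 0 * w 1 - v 1 * w 0)) :
    IsPrimitive v := by
  refine ⟨?_, ?_⟩
  · rintro rfl
    simp at h
  · rintro m hm u rfl
    have h1 : IsUnit ((m : ℤ) * (u 0 * w 1 - u 1 * w 0)) := by
      convert h using 1
      simp only [Pi.smul_apply, smul_eq_mul]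
      ring
    have h2 := Int.isUnit_iff.1 (isUnit_of_mul_isUnit_left h1)
    omega

lemma exists_int_mul_of_smul_eq {v w : Fin 2 → ℤ} (hv : IsPrimitive v) {k l : ℝ}
    (h : ∀ i, k * v i = l * w i) : ∃ n : ℤ, k = l * n := by
  obtain ⟨p, q, hpq⟩ := hv.isCoprime
  refine ⟨p * w 0 + q * w 1, ?_⟩
  have : (p : ℝ) * v 0 + q * v 1 = 1 := by exact_mod_cast hpq
  push_cast
  linear_combination (-k) * this + p * h 0 + q * h 1

lemma RatLength.unique {d : Set (Pt 2)} {k l : ℝ} (hk : RatLength d k) (hl : RatLength d l) :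
    k = l := by
  obtain ⟨hk0, a, v, hv, hd⟩ := hk
  obtain ⟨hl0, b, w, hw, hd'⟩ := hl
  have hne : a ≠ a + k • fun i => (v i : ℝ) := by
    intro h
    refine hv.1 (funext fun i => ?_)
    have := congrFun h i
    simpa [hk0.ne'] using this
  obtain ⟨ε, hε, h⟩ : ∃ ε : ℝ, (ε = 1 ∨ ε = -1) ∧ ∀ i, k * v i = ε * l * w i := by
    rcases sub_eq_or_eq_neg_of_segment_eq hne (hd.symm.trans hd') with h | h
    · refine ⟨1, Or.inl rfl, fun i => ?_⟩
      simpa using congrFun h i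
    · refine ⟨-1, Or.inr rfl, fun i => ?_⟩
      simpa using congrFun h i
  have hε2 : ε * ε = 1 := by rcases hε with rfl | rfl <;> norm_num
  obtain ⟨m, hm⟩ := exists_int_mul_of_smul_eq hv h
  obtain ⟨n, hn⟩ := exists_int_mul_of_smul_eq (k := ε * l) (l := k) hw fun i => (h i).symm
  have hmn : (m : ℝ) * n = 1 := by
    have : k * (m * n - 1) = 0 := by
      linear_combination (-1 : ℝ) * hm - (m : ℝ) * hn
    rcases mul_eq_zero.1 this with h | h
    · exact absurd h hk0.ne'
    · linarith
  have hm1 : m = 1 ∨ m = -1 := by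
    have : m * n = 1 := by exact_mod_cast hmn
    exact Int.eq_one_or_neg_one_of_mul_eq_one this
  rcases hε with rfl | rfl <;> rcases hm1 with rfl | rfl <;> push_cast at hm <;> linarith

/-- A linear functional on the plane whose kernel is the line spanned by `d`. -/
lemma exists_ker_eq_line {d : Pt 2} (hd : d ≠ 0) :
    ∃ g : Pt 2 →ₗ[ℝ] ℝ, ∀ x, g x = 0 ↔ ∃ t : ℝ, x = t • d := by
  let g : Pt 2 →ₗ[ℝ] ℝ := d 0 • LinearMap.proj 1 - d 1 • LinearMap.proj 0
  have hg : ∀ x, g x = d 0 * x 1 - d 1 * x 0 := fun x => rfl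
  refine ⟨g, fun x => ⟨fun h => ?_, ?_⟩⟩
  · rw [hg] at h
    by_cases h0 : d 0 = 0
    · have h1 : d 1 ≠ 0 := fun h1 => hd (funext fun i => by fin_cases i <;> simp [h0, h1])
      refine ⟨x 1 / d 1, funext fun i => ?_⟩
      fin_cases i
      · have : x 0 = 0 := by simpa [h0, h1] using h
        simp [h0, this]
      · simp [h1]
    · refine ⟨x 0 / d 0, funext fun i => ?_⟩
      fin_cases i
      · simp [h0]
      · simp only [Fin.mk_one, Pi.smul_apply, smul_eq_mul]
        field_simp
        linarith
  · rintro ⟨t, rfl⟩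
    rw [hg]
    simp only [Pi.smul_apply, smul_eq_mul]
    ring

/-- A convex planar set lies on one side of the line through any of its edges. -/
lemma side_of_isExtreme_segment {K : Set (Pt 2)} (hK : Convex ℝ K) {a b : Pt 2}
    (he : IsExtreme ℝ K (segment ℝ a b)) {g : Pt 2 →ₗ[ℝ] ℝ}
    (hg : ∀ x, g x = 0 ↔ ∃ t : ℝ, x = t • (b - a)) :
    (∀ x ∈ K, g a ≤ g x) ∨ ∀ x ∈ K, g x ≤ g a := by
  by_contra! hcon
  obtain ⟨⟨x, hx, hxa⟩, y, hy, hya⟩ := hcon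
  set r := (g a - g x) / (g y - g x) with hr
  have hr0 : 0 < r := div_pos (by linarith) (by linarith)
  have hr1 : r < 1 := (div_lt_one (by linarith)).2 (by linarith)
  have hz : g (x + r • (y - x) - a) = 0 := by
    simp only [map_sub, map_add, map_smul, smul_eq_mul, hr]
    field_simp [show g y - g x ≠ 0 by linarith]
    ring
  obtain ⟨τ, hτ⟩ := (hg _).1 hz
  obtain ⟨t, ht0, ht1, htτ⟩ : ∃ t : ℝ, 0 < t ∧ t ≤ 1 ∧ |t * (τ - 1 / 2)| ≤ 1 / 2 := by
    refine ⟨1 / (2 * (|τ - 1 / 2| + 1)), by positivity, ?_, ?_⟩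
    · rw [div_le_one (by positivity)]; linarith [abs_nonneg (τ - 1 / 2)]
    · rw [abs_mul, abs_of_pos (by positivity), div_mul_eq_mul_div, div_le_div_iff₀ (by positivity)
        (by norm_num)]
      linarith [abs_nonneg (τ - 1 / 2)]
  rw [abs_le] at htτ
  set m : Pt 2 := a + (1 / 2 : ℝ) • (b - a) with hm
  have hmK : m ∈ K := he.subset (mem_segment_iff_add_smul.2 ⟨1 / 2, by norm_num, by norm_num, rfl⟩)
  have hsh : ∀ w ∈ K, m + t • (w - m) ∈ K := fun w hw => hK.add_smul_sub_mem hmK hw ⟨ht0.le, ht1⟩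
  have hmem : (m + t • (x - m)) + r • ((m + t • (y - m)) - (m + t • (x - m))) ∈ segment ℝ a b := by
    refine mem_segment_iff_add_smul.2 ⟨1 / 2 + t * (τ - 1 / 2), by linarith, by linarith, ?_⟩
    have h1 : x + r • (y - x) = a + τ • (b - a) := by rw [← hτ]; module
    have h2 : (m + t • (x - m)) + r • ((m + t • (y - m)) - (m + t • (x - m))) =
        m + t • ((x + r • (y - x)) - m) := by module
    rw [h2, h1, hm]; module
  have hX := he.left_mem_of_mem_openSegment (hsh x hx) (hsh y hy) hmem (mem_openSegment_of_add_smul hr0 hr1)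
  obtain ⟨σ, -, -, hσ⟩ := mem_segment_iff_add_smul.1 hX
  have h3 : g (b - a) = 0 := (hg _).2 ⟨1, by simp⟩
  have h4 : g m = g a := by rw [hm, map_add, map_smul, h3]; simp
  clear_value m
  have h5 := congrArg g hσ
  rw [map_add, map_add, map_smul, map_smul, h3, map_sub, h4] at h5
  have : t * (g x - g a) = 0 := by simpa using h5
  have := mul_pos ht0 (sub_pos.2 hxa)
  linarith

lemma mem_segment_of_isExtreme {K : Set (Pt 2)} {a b x : Pt 2}
    (he : IsExtreme ℝ K (segment ℝ a b)) (hx : x ∈ K) {t : ℝ} (hxt : x - a = t • (b - a)) :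
    x ∈ segment ℝ a b := by
  have hxe : x = a + t • (b - a) := by rw [← hxt]; module
  have ha := left_mem_segment ℝ a b
  have hb := right_mem_segment ℝ a b
  rcases lt_or_ge t 0 with h0 | h0
  · refine he.left_mem_of_mem_openSegment hx (he.subset hb) ha ?_
    have h1 : 0 < 1 - t := by linarith
    have := mem_openSegment_of_add_smul (x := x) (y := b) (t := -t / (1 - t))
      (div_pos (by linarith) h1) ((div_lt_one h1).2 (by linarith))
    convert this using 1
    rw [hxe]
    match_scalars <;> field_simp <;> ring
  rcases le_or_gt t 1 with h1 | h1
  · exact mem_segment_iff_add_smul.2 ⟨t, h0, h1, hxe⟩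
  · refine he.left_mem_of_mem_openSegment hx (he.subset ha) hb ?_
    rw [openSegment_symm]
    have := mem_openSegment_of_add_smul (x := a) (y := x) (t := 1 / t)
      (by positivity) ((div_lt_one (by linarith)).2 (by linarith))
    convert this using 1
    rw [hxe]
    match_scalars <;> field_simp
    ring

/-- A compact convex subset of a line with two distinct points is a segment. -/
lemma exists_eq_segment_of_subset_line {C : Set (Pt 2)} (hC : IsCompact C) (hconv : Convex ℝ C)
    {a d : Pt 2} (hd : d ≠ 0) (hline : ∀ x ∈ C, ∃ t : ℝ, x = a + t • d)
    {x y : Pt 2} (hx : x ∈ C) (hy : y ∈ C) (hxy : x ≠ y) :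
    ∃ p q : Pt 2, p ≠ q ∧ C = segment ℝ p q := by
  have hT : IsCompact {t : ℝ | a + t • d ∈ C} := by
    have : Topology.IsClosedEmbedding fun t : ℝ => a + t • d :=
      (Homeomorph.addLeft a).isClosedEmbedding.comp (isClosedEmbedding_smul_left hd)
    exact this.isCompact_preimage hC
  obtain ⟨s, hs⟩ := hline x hx
  obtain ⟨t, ht⟩ := hline y hy
  have hne : {t : ℝ | a + t • d ∈ C}.Nonempty := ⟨s, by simpa [← hs] using hx⟩
  obtain ⟨m, hm, hmin⟩ := hT.exists_isLeast hne
  obtain ⟨M, hM, hmax⟩ := hT.exists_isGreatest hne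
  have key : C = segment ℝ (a + m • d) (a + M • d) := by
    refine Set.Subset.antisymm (fun z hz => ?_) (hconv.segment_subset hm hM)
    obtain ⟨r, rfl⟩ := hline z hz
    have h1 : m ≤ r := hmin hz
    have h2 : r ≤ M := hmax hz
    rcases eq_or_lt_of_le (h1.trans h2) with h | h
    · have : r = m := by linarith
      rw [this]; exact left_mem_segment ℝ _ _
    · refine mem_segment_iff_add_smul.2 ⟨(r - m) / (M - m), div_nonneg (by linarith) (by linarith),
        (div_le_one (by linarith)).2 (by linarith), ?_⟩
      have : M - m ≠ 0 := by linarith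
      match_scalars <;> field_simp <;> ring
  refine ⟨_, _, fun h => hxy ?_, key⟩
  rw [← h, segment_same] at key
  rw [key] at hx hy
  exact hx.trans hy.symm

lemma IsExtreme.inter_right {K e : Set (Pt 2)} (he : IsExtreme ℝ K e) (H : Set (Pt 2)) :
    IsExtreme ℝ (K ∩ H) (e ∩ H) :=
  ⟨Set.inter_subset_inter_left _ he.subset, fun _ hx _ hy _ hz hzxy =>
    ⟨he.left_mem_of_mem_openSegment hx.1 hy.1 hz.1 hzxy, hx.2⟩⟩

lemma isExtreme_of_forall_le {K : Set (Pt 2)} {g : Pt 2 →ₗ[ℝ] ℝ} {c : ℝ}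
    (h : ∀ x ∈ K, c ≤ g x) : IsExtreme ℝ K (K ∩ {x | g x = c}) := by
  refine ⟨Set.inter_subset_left, fun x hx y hy z hz hzxy => ⟨hx, ?_⟩⟩
  obtain ⟨p, q, hp, hq, hpq, rfl⟩ := hzxy
  have hgz : p * g x + q * g y = c := by simpa using hz.2
  have h1 := mul_nonneg hq.le (sub_nonneg.2 (h y hy))
  have h2 : p * (g x - c) ≤ 0 := by
    have : p * c + q * c = c := by rw [← add_mul, hpq, one_mul]
    linarith
  have h3 := h x hx
  exact le_antisymm (by nlinarith) h3

/-- An extreme subsegment of a segment is the whole segment. -/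
lemma segment_eq_of_isExtreme {K : Set (Pt 2)} {a b p q : Pt 2} (hab : a ≠ b)
    (he : IsExtreme ℝ K (segment ℝ a b)) (hsub : segment ℝ a b ⊆ segment ℝ p q)
    (hpq : segment ℝ p q ⊆ K) : segment ℝ a b = segment ℝ p q := by
  obtain ⟨s, hs0, hs1, hs⟩ := mem_segment_iff_add_smul.1 (hsub (left_mem_segment ℝ a b))
  obtain ⟨t, ht0, ht1, ht⟩ := mem_segment_iff_add_smul.1 (hsub (right_mem_segment ℝ a b))
  have hst : s ≠ t := by
    rintro rfl
    exact hab (hs.trans ht.symm)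
  have hr : 0 < (s + t) / 2 ∧ (s + t) / 2 < 1 := by
    rcases lt_or_gt_of_ne hst with h | h <;> constructor <;> linarith
  have hm : p + ((s + t) / 2) • (q - p) ∈ segment ℝ a b :=
    mem_segment_iff_add_smul.2 ⟨1 / 2, by norm_num, by norm_num, by rw [hs, ht]; module⟩
  have ho := mem_openSegment_of_add_smul (x := p) (y := q) hr.1 hr.2
  have hpK := hpq (left_mem_segment ℝ p q)
  have hqK := hpq (right_mem_segment ℝ p q)
  refine hsub.antisymm ((convex_segment a b).segment_subset ?_ ?_)
  · exact he.left_mem_of_mem_openSegment hpK hqK hm ho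
  · exact he.right_mem_of_mem_openSegment hpK hqK hm ho

/-- Every edge of `K ∩ {r ≤ f}` not contained in the line `f = r` is cut out of an edge of `K`. -/
lemma IsEdge.exists_of_inter_halfPlane {K : Set (Pt 2)} (hc : IsCompact K) (hK : Convex ℝ K)
    {f : Pt 2 →ₗ[ℝ] ℝ} {r : ℝ} {e : Set (Pt 2)} (he : IsEdge (K ∩ {x | r ≤ f x}) e)
    {x₀ : Pt 2} (hx₀ : x₀ ∈ e) (hfx₀ : r < f x₀) :
    ∃ e', IsEdge K e' ∧ e = e' ∩ {x | r ≤ f x} := by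
  obtain ⟨⟨a, b, hab, rfl⟩, hext⟩ := he
  have hK' : Convex ℝ (K ∩ {x | r ≤ f x}) := hK.inter (convex_halfSpace_ge f.isLinear r)
  have ha := hext.subset (left_mem_segment ℝ a b)
  have hb := hext.subset (right_mem_segment ℝ a b)
  have hd : b - a ≠ 0 := sub_ne_zero.2 hab.symm
  obtain ⟨g, hg⟩ := exists_ker_eq_line hd
  have hgab : g (b - a) = 0 := (hg _).2 ⟨1, by simp⟩
  obtain ⟨m, hmK, hgm, hfm⟩ : ∃ m ∈ K, g m = g a ∧ r < f m := by
    obtain ⟨t, ht0, ht1, rfl⟩ := mem_segment_iff_add_smul.1 hx₀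
    exact ⟨_, (hext.subset hx₀).1, by rw [map_add, map_smul, hgab]; simp, hfx₀⟩
  have hside : ∀ h : Pt 2 →ₗ[ℝ] ℝ, h m = h a → (∀ x ∈ K ∩ {x | r ≤ f x}, h a ≤ h x) →
      ∀ x ∈ K, h a ≤ h x := by
    intro h hma hh x hx
    have hpos : 0 < f m - r + |f x - f m| := by linarith [abs_nonneg (f x - f m)]
    set t := (f m - r) / (f m - r + |f x - f m|) with ht
    have ht0 : 0 < t := div_pos (sub_pos.2 hfm) hpos
    have ht1 : t ≤ 1 := (div_le_one hpos).2 (by linarith [abs_nonneg (f x - f m)])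
    have hmem : m + t • (x - m) ∈ K ∩ {x | r ≤ f x} := by
      refine ⟨hK.add_smul_sub_mem hmK hx ⟨ht0.le, ht1⟩, ?_⟩
      have h1 : t * (f m - r + |f x - f m|) = f m - r := div_mul_cancel₀ _ hpos.ne'
      have h2 := mul_le_mul_of_nonneg_left (neg_abs_le (f x - f m)) ht0.le
      have h3 := mul_pos ht0 (sub_pos.2 hfm)
      simp only [Set.mem_ofPred_eq, map_add, map_smul, map_sub, smul_eq_mul]
      linarith
    have h4 := hh _ hmem
    rw [map_add, map_smul, map_sub, hma, smul_eq_mul] at h4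
    exact sub_nonneg.1 (nonneg_of_mul_nonneg_right (by linarith) ht0)
  have hface : IsExtreme ℝ K (K ∩ {x | g x = g a}) := by
    rcases side_of_isExtreme_segment hK' hext hg with h | h
    · exact isExtreme_of_forall_le (hside g hgm h)
    · have := isExtreme_of_forall_le (hside (-g) (by simp [hgm]) (by simpa using h))
      simpa using this
  have hline : ∀ x, g x = g a → ∃ t : ℝ, x = a + t • (b - a) := fun x hx => by
    obtain ⟨t, ht⟩ := (hg (x - a)).1 (by rw [map_sub, hx, sub_self])
    exact ⟨t, by rw [← ht]; module⟩
  have hgseg : ∀ x ∈ segment ℝ a b, g x = g a := fun x hx => by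
    obtain ⟨t, -, -, rfl⟩ := mem_segment_iff_add_smul.1 hx
    rw [map_add, map_smul, hgab]; simp
  have hcl : IsClosed {x | g x = g a} :=
    isClosed_eq g.continuous_of_finiteDimensional continuous_const
  refine ⟨K ∩ {x | g x = g a}, ⟨?_, hface⟩, ?_⟩
  · exact exists_eq_segment_of_subset_line (hc.inter_right hcl)
      (hK.inter (convex_hyperplane g.isLinear _)) hd (fun x hx => hline x hx.2)
      ⟨ha.1, rfl⟩ ⟨hb.1, hgseg b (right_mem_segment ℝ a b)⟩ hab
  · refine Set.Subset.antisymm (fun x hx => ?_) (fun x hx => ?_)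
    · exact ⟨⟨(hext.subset hx).1, hgseg x hx⟩, (hext.subset hx).2⟩
    · obtain ⟨t, ht⟩ := hline x hx.1.2
      exact mem_segment_of_isExtreme hext ⟨hx.1.1, hx.2⟩ (t := t) (by rw [ht]; module)

/-- `φ` and `ψ` are the coordinates of the plane in the basis `α`, `β`. -/
structure IsCoordPair (α β : Pt 2) (φ ψ : Pt 2 →ₗ[ℝ] ℝ) : Prop where
  eq_add : ∀ x, x = φ x • α + ψ x • β
  fst_left : φ α = 1
  fst_right : φ β = 0
  snd_left : ψ α = 0
  snd_right : ψ β = 1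

lemma IsCoordPair.swap {α β : Pt 2} {φ ψ : Pt 2 →ₗ[ℝ] ℝ} (h : IsCoordPair α β φ ψ) :
    IsCoordPair β α ψ φ :=
  ⟨fun x => by rw [add_comm]; exact h.eq_add x, h.snd_right, h.snd_left, h.fst_right, h.fst_left⟩

/-- A vertex `v` of `K` with edges of lengths `k` and `l` in the directions `α` and `β`, and a
number `δ` smaller than both lengths. -/
structure IsPlaneCorner (K : Set (Pt 2)) (v α β : Pt 2) (k l δ : ℝ) (φ ψ : Pt 2 →ₗ[ℝ] ℝ) : Prop where
  convex : Convex ℝ K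
  coord : IsCoordPair α β φ ψ
  pos : 0 < δ
  lt_left : δ < k
  lt_right : δ < l
  left : IsExtreme ℝ K (segment ℝ v (v + k • α))
  right : IsExtreme ℝ K (segment ℝ v (v + l • β))

namespace IsPlaneCorner

variable {K : Set (Pt 2)} {v α β : Pt 2} {k l δ : ℝ} {φ ψ : Pt 2 →ₗ[ℝ] ℝ}

lemma swap (h : IsPlaneCorner K v α β k l δ φ ψ) : IsPlaneCorner K v β α l k δ ψ φ :=
  ⟨h.convex, h.coord.swap, h.pos, h.lt_right, h.lt_left, h.right, h.left⟩

lemma eq_add (h : IsPlaneCorner K v α β k l δ φ ψ) (x : Pt 2) :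
    x = v + φ (x - v) • α + ψ (x - v) • β := by
  rw [add_assoc, ← h.coord.eq_add]; module

lemma fst_apply (h : IsPlaneCorner K v α β k l δ φ ψ) (s t : ℝ) :
    φ (v + s • α + t • β - v) = s := by
  rw [add_assoc, add_sub_cancel_left]
  simp [h.coord.fst_left, h.coord.fst_right]

lemma fst_eq_zero (h : IsPlaneCorner K v α β k l δ φ ψ) {x : Pt 2}
    (hx : x ∈ segment ℝ v (v + l • β)) : φ (x - v) = 0 := by
  obtain ⟨t, -, -, rfl⟩ := mem_segment_iff_add_smul.1 hx
  simp [h.coord.fst_right]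

lemma mem_left (h : IsPlaneCorner K v α β k l δ φ ψ) {t : ℝ} (h0 : 0 ≤ t) (h1 : t ≤ k) :
    v + t • α ∈ segment ℝ v (v + k • α) := by
  have hk : 0 < k := h.pos.trans h.lt_left
  refine mem_segment_iff_add_smul.2 ⟨t / k, by positivity, (div_le_one hk).2 h1, ?_⟩
  match_scalars <;> field_simp
  ring

lemma mem_of_add_le (h : IsPlaneCorner K v α β k l δ φ ψ) {s t : ℝ} (hs : 0 ≤ s) (ht : 0 ≤ t)
    (hst : s + t ≤ δ) : v + s • α + t • β ∈ K := by
  have hδ := h.pos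
  have hv : v ∈ K := h.left.subset (left_mem_segment ℝ _ _)
  have hα : v + δ • α ∈ K := h.left.subset (h.mem_left hδ.le h.lt_left.le)
  have hβ : v + δ • β ∈ K := h.right.subset (h.swap.mem_left hδ.le h.lt_right.le)
  rcases (add_nonneg hs ht).eq_or_lt with h0 | h0
  · have h1 : s = 0 := by linarith
    have h2 : t = 0 := by linarith
    simpa [h1, h2] using hv
  have h1 := h.convex hα hβ (div_nonneg hs h0.le) (div_nonneg ht h0.le) (by field_simp)
  have h2 := h.convex.add_smul_sub_mem hv h1 ⟨div_nonneg h0.le hδ.le, (div_le_one hδ).2 hst⟩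
  convert h2 using 1
  match_scalars <;> field_simp
  ring

lemma fst_nonneg (h : IsPlaneCorner K v α β k l δ φ ψ) {x : Pt 2} (hx : x ∈ K) : 0 ≤ φ (x - v) := by
  by_contra! ha
  have hδ := h.pos
  have hl : 0 < l := hδ.trans h.lt_right
  suffices x ∈ segment ℝ v (v + l • β) from ha.ne (h.fst_eq_zero this)
  have hxe := h.eq_add x
  set a := φ (x - v)
  set b := ψ (x - v)
  clear_value a b
  rcases le_or_gt 0 b with hb | hb
  · obtain ⟨t, ht0, htδ, htl⟩ : ∃ t, 0 < t ∧ t ≤ δ ∧ b * t ≤ l * (-a) := by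
      refine ⟨min δ (l * (-a) / (b + 1)), lt_min hδ (div_pos (mul_pos hl (by linarith))
        (by linarith)), min_le_left _ _, ?_⟩
      calc b * min δ (l * (-a) / (b + 1)) ≤ b * (l * (-a) / (b + 1)) := by
            gcongr; exact min_le_right _ _
        _ ≤ (b + 1) * (l * (-a) / (b + 1)) := by
            gcongr
            · exact div_nonneg (mul_nonneg hl.le (by linarith)) (by linarith)
            · linarith
        _ = l * (-a) := by field_simp
    have hta : 0 < t - a := by linarith
    have hq : v + t • α + (0 : ℝ) • β ∈ K := h.mem_of_add_le ht0.le le_rfl (by linarith)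
    have hz := h.swap.mem_left (t := b * t / (t - a)) (by positivity)
      ((div_le_iff₀ hta).2 (by nlinarith))
    refine h.right.left_mem_of_mem_openSegment hx hq hz ?_
    have := mem_openSegment_of_add_smul (x := x) (y := v + t • α + (0 : ℝ) • β) (t := -a / (t - a))
      (div_pos (by linarith) hta) ((div_lt_one hta).2 (by linarith))
    convert this using 1
    rw [hxe]
    match_scalars <;> field_simp <;> ring
  · have hab : 0 < -a - b := by linarith
    set ε := δ / (-a - b) with hε
    have hε0 : 0 < ε := div_pos hδ hab
    have hεab : ε * (-a - b) = δ := div_mul_cancel₀ _ hab.ne'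
    have hq : v + (ε * (-a)) • α + (ε * (-b)) • β ∈ K :=
      h.mem_of_add_le (mul_nonneg hε0.le (by linarith)) (mul_nonneg hε0.le (by linarith))
        (by linarith)
    refine h.right.left_mem_of_mem_openSegment hx hq (left_mem_segment ℝ _ _) ?_
    have := mem_openSegment_of_add_smul (x := x) (y := v + (ε * (-a)) • α + (ε * (-b)) • β)
      (t := 1 / (1 + ε)) (by positivity) ((div_lt_one (by positivity)).2 (by linarith))
    convert this using 1
    rw [hxe]
    clear_value ε
    match_scalars <;> field_simp <;> ring

lemma le_of_vertex_notMem (h : IsPlaneCorner K v α β k l δ φ ψ) {e : Set (Pt 2)}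
    (he : IsExtreme ℝ K e) (hv : v ∉ e) {x : Pt 2} (hx : x ∈ e) :
    δ ≤ φ (x - v) + ψ (x - v) := by
  by_contra! hlt
  have h1 := h.fst_nonneg (he.subset hx)
  have h2 := h.swap.fst_nonneg (he.subset hx)
  have hxe := h.eq_add x
  set a := φ (x - v)
  set b := ψ (x - v)
  clear_value a b
  rcases (add_nonneg h1 h2).eq_or_lt with h0 | h0
  · have h3 : a = 0 := by linarith
    have h4 : b = 0 := by linarith
    rw [h3, h4, zero_smul, zero_smul, add_zero, add_zero] at hxe
    exact hv (hxe ▸ hx)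
  · have hδ := h.pos
    have hw : v + (δ / (a + b) * a) • α + (δ / (a + b) * b) • β ∈ K :=
      h.mem_of_add_le (by positivity) (by positivity) (le_of_eq (by field_simp))
    refine hv (he.left_mem_of_mem_openSegment (h.left.subset (left_mem_segment ℝ _ _)) hw hx ?_)
    have := mem_openSegment_of_add_smul (x := v)
      (y := v + (δ / (a + b) * a) • α + (δ / (a + b) * b) • β) (t := (a + b) / δ)
      (by positivity) ((div_lt_one hδ).2 hlt)
    convert this using 1
    rw [hxe]
    match_scalars <;> field_simp
    ring

lemma vertex_mem (h : IsPlaneCorner K v α β k l δ φ ψ) {e : Set (Pt 2)} (he : IsExtreme ℝ K e)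
    (hx : v + δ • α ∈ e) : v ∈ e := by
  have hk : 0 < k := h.pos.trans h.lt_left
  refine he.left_mem_of_mem_openSegment (h.left.subset (left_mem_segment ℝ _ _))
    (h.left.subset (right_mem_segment ℝ _ _)) hx ?_
  have := mem_openSegment_of_add_smul (x := v) (y := v + k • α) (t := δ / k)
    (div_pos h.pos hk) ((div_lt_one hk).2 h.lt_left)
  convert this using 1
  match_scalars <;> field_simp
  ring

lemma left_inter (h : IsPlaneCorner K v α β k l δ φ ψ) :
    segment ℝ v (v + k • α) ∩ {x | δ ≤ φ (x - v) + ψ (x - v)} =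
      segment ℝ (v + δ • α) (v + k • α) := by
  have hk : 0 < k := h.pos.trans h.lt_left
  have hkδ : 0 < k - δ := sub_pos.2 h.lt_left
  have hδ := h.pos
  ext x
  simp only [Set.mem_inter_iff, mem_segment_iff_add_smul, Set.mem_ofPred_eq]
  constructor
  · rintro ⟨⟨t, ht0, ht1, rfl⟩, hx⟩
    have hx' : δ ≤ t * k := by simpa [h.coord.fst_left, h.coord.snd_left] using hx
    refine ⟨(t * k - δ) / (k - δ), div_nonneg (by linarith) hkδ.le, (div_le_one hkδ).2 ?_, ?_⟩
    · nlinarith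
    · match_scalars <;> field_simp <;> ring
  · rintro ⟨t, ht0, ht1, rfl⟩
    refine ⟨⟨(δ + t * (k - δ)) / k, by positivity, (div_le_one hk).2 (by nlinarith), ?_⟩, ?_⟩
    · match_scalars <;> field_simp
      ring
    · have : v + δ • α + t • (v + k • α - (v + δ • α)) - v = (δ + t * (k - δ)) • α := by module
      rw [this]
      simp only [map_smul, h.coord.fst_left, h.coord.snd_left, smul_eq_mul]
      nlinarith

lemma inter_line (h : IsPlaneCorner K v α β k l δ φ ψ) :
    K ∩ {x | φ (x - v) + ψ (x - v) = δ} = segment ℝ (v + δ • α) (v + δ • β) := by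
  have hδ := h.pos
  ext x
  simp only [Set.mem_inter_iff, mem_segment_iff_add_smul, Set.mem_ofPred_eq]
  constructor
  · rintro ⟨hx, hxδ⟩
    have h1 := h.fst_nonneg hx
    have h2 := h.swap.fst_nonneg hx
    have hxe := h.eq_add x
    refine ⟨ψ (x - v) / δ, div_nonneg h2 hδ.le, (div_le_one hδ).2 (by linarith), ?_⟩
    have ha : φ (x - v) = δ - ψ (x - v) := by linarith
    rw [ha] at hxe
    set b := ψ (x - v)
    clear_value b
    rw [hxe]
    match_scalars <;> field_simp <;> ring
  · rintro ⟨t, ht0, ht1, rfl⟩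
    have hx : v + δ • α + t • (v + δ • β - (v + δ • α)) =
        v + ((1 - t) * δ) • α + (t * δ) • β := by module
    rw [hx]
    refine ⟨h.mem_of_add_le (mul_nonneg (by linarith) hδ.le) (by positivity) (by linarith), ?_⟩
    rw [h.fst_apply, add_right_comm, h.swap.fst_apply]
    ring

lemma isEdge_inter_iff (h : IsPlaneCorner K v α β k l δ φ ψ) (hc : IsCompact K)
    (hedges : ∀ e, IsEdge K e → v ∈ e →
      e = segment ℝ v (v + k • α) ∨ e = segment ℝ v (v + l • β)) (e : Set (Pt 2)) :
    IsEdge (K ∩ {x | δ ≤ φ (x - v) + ψ (x - v)}) e ↔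
      e = segment ℝ (v + δ • α) (v + δ • β) ∨ e = segment ℝ (v + δ • α) (v + k • α) ∨
        e = segment ℝ (v + δ • β) (v + l • β) ∨ (IsEdge K e ∧ v ∉ e) := by
  have hset : {x | δ ≤ φ (x - v) + ψ (x - v)} = {x | δ + (φ + ψ) v ≤ (φ + ψ) x} := by
    ext x
    simp only [Set.mem_ofPred_eq, map_sub, LinearMap.add_apply]
    constructor <;> intro h <;> linarith
  have hset' : {x | φ (x - v) + ψ (x - v) = δ} = {x | (φ + ψ) x = δ + (φ + ψ) v} := by
    ext x
    simp only [Set.mem_ofPred_eq, map_sub, LinearMap.add_apply]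
    constructor <;> intro h <;> linarith
  have hcut : (K ∩ {x | δ ≤ φ (x - v) + ψ (x - v)}) ∩ {x | φ (x - v) + ψ (x - v) = δ} =
      segment ℝ (v + δ • α) (v + δ • β) := by
    rw [Set.inter_assoc, ← h.inter_line]
    congr 1
    exact Set.inter_eq_right.2 fun x hx => hx.ge
  have hcutExt : IsExtreme ℝ (K ∩ {x | δ ≤ φ (x - v) + ψ (x - v)})
      (segment ℝ (v + δ • α) (v + δ • β)) := by
    rw [← hcut, hset', hset]
    exact isExtreme_of_forall_le fun x hx => hx.2
  have hright : segment ℝ v (v + l • β) ∩ {x | δ ≤ φ (x - v) + ψ (x - v)} =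
      segment ℝ (v + δ • β) (v + l • β) := by
    rw [← h.swap.left_inter]
    simp only [add_comm]
  have hfar : ∀ e, IsEdge K e → v ∉ e → e ∩ {x | δ ≤ φ (x - v) + ψ (x - v)} = e :=
    fun e he hv => Set.inter_eq_left.2 fun x hx => h.le_of_vertex_notMem he.2 hv hx
  constructor
  · intro he
    by_cases hall : ∀ x ∈ e, φ (x - v) + ψ (x - v) = δ
    · left
      obtain ⟨⟨a, b, hab, rfl⟩, hext⟩ := he
      refine segment_eq_of_isExtreme hab hext ?_ hcutExt.subset
      rw [← hcut]
      exact fun x hx => ⟨hext.subset hx, hall x hx⟩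
    · push Not at hall
      obtain ⟨x₀, hx₀, hne⟩ := hall
      have hlt : δ < φ (x₀ - v) + ψ (x₀ - v) := lt_of_le_of_ne (he.2.subset hx₀).2 hne.symm
      rw [hset] at he
      obtain ⟨e', he', hee'⟩ := he.exists_of_inter_halfPlane hc h.convex hx₀ (by
        simp only [map_sub] at hlt
        simp only [LinearMap.add_apply]
        linarith)
      rw [← hset] at hee'
      right
      by_cases hv : v ∈ e'
      · rcases hedges e' he' hv with rfl | rfl
        · left; rw [hee', h.left_inter]
        · right; left; rw [hee', hright]
      · right; right
        rw [hfar e' he' hv] at hee'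
        exact hee' ▸ ⟨he', hv⟩
  · have hαβ : ∀ s t : ℝ, t ≠ 0 → v + s • β ≠ v + t • α := fun s t ht hst => by
      have := congrArg (fun x => φ (x - v)) hst
      simp [h.coord.fst_left, h.coord.fst_right] at this
      exact ht this.symm
    have hne : ∀ {p q : ℝ} {γ : Pt 2}, γ ≠ 0 → p < q → v + p • γ ≠ v + q • γ :=
      fun hγ hpq hst => hpq.ne (smul_left_injective ℝ hγ (add_left_cancel hst))
    rintro (rfl | rfl | rfl | ⟨he, hv⟩)
    · exact ⟨⟨_, _, (hαβ _ _ h.pos.ne').symm, rfl⟩, hcutExt⟩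
    · refine ⟨⟨_, _, hne ?_ h.lt_left, rfl⟩, ?_⟩
      · rintro rfl; simpa using h.coord.fst_left
      · rw [← h.left_inter]; exact h.left.inter_right _
    · refine ⟨⟨_, _, hne ?_ h.lt_right, rfl⟩, ?_⟩
      · rintro rfl; simpa using h.coord.snd_right
      · rw [← hright]; exact h.right.inter_right _
    · refine ⟨he.1, ?_⟩
      rw [← hfar e he hv]
      exact he.2.inter_right _

end IsPlaneCorner

lemma IsLatticeBasis.exists_coord {α : Fin 2 → Pt 2} (h : IsLatticeBasis α) :
    ∃ φ ψ : Pt 2 →ₗ[ℝ] ℝ, IsCoordPair (α 0) (α 1) φ ψ := by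
  obtain ⟨A, hA, hα⟩ := h
  have hD : α 0 0 * α 1 1 - α 0 1 * α 1 0 ≠ 0 := by
    rw [Matrix.det_fin_two] at hA
    simp only [hα]
    exact_mod_cast hA.ne_zero
  set D := α 0 0 * α 1 1 - α 0 1 * α 1 0 with hDdef
  refine ⟨D⁻¹ • (α 1 1 • LinearMap.proj 0 - α 1 0 • LinearMap.proj 1),
    D⁻¹ • (α 0 0 • LinearMap.proj 1 - α 0 1 • LinearMap.proj 0), fun x => funext fun i => ?_,
    ?_, ?_, ?_, ?_⟩
  · fin_cases i <;> simp <;> field_simp <;> rw [hDdef] <;> ring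
  · simp
    field_simp
    rw [hDdef]
    ring
  · simp [mul_comm]
  · simp [mul_comm]
  · simp
    field_simp
    rw [hDdef]

lemma ratLength_of_det {a b : Pt 2} {v w : Fin 2 → ℤ} {l : ℝ} (hl : 0 < l)
    (hdet : IsUnit (v 0 * w 1 - v 1 * w 0)) (hb : ∀ i, b i - a i = l * v i) :
    RatLength (segment ℝ a b) l := by
  refine ⟨hl, a, v, isPrimitive_of_det hdet, ?_⟩
  congr 1
  funext i
  simp [← hb i]

lemma IsCornerChop.hasPerimeter {Δ Δ' : Set (Pt 2)} {v : Pt 2} {δ P : ℝ}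
    (hc : IsCompact Δ) (hconv : Convex ℝ Δ) (h : IsCornerChop Δ v δ Δ')
    (hP : HasPerimeter Δ P) : HasPerimeter Δ' (P - δ) := by
  classical
  obtain ⟨-, hδ, α, ℓ, hα, hℓ, hedges, rfl⟩ := h
  obtain ⟨E, len, hE, hlen, rfl⟩ := hP
  obtain ⟨φ, ψ, hcoord⟩ := hα.exists_coord
  obtain ⟨A, hA, hαA⟩ := hα
  rw [Matrix.det_fin_two] at hA
  have hmemE : ∀ e, e ∈ E ↔ IsEdge Δ e := fun e => by
    rw [← Finset.mem_coe, hE]; rfl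
  have hvert : ∀ e, IsEdge Δ e ∧ v ∈ e ↔
      e = segment ℝ v (v + ℓ 0 • α 0) ∨ e = segment ℝ v (v + ℓ 1 • α 1) := fun e => by
    have := Set.ext_iff.1 hedges e
    simpa [Fin.exists_fin_two] using this
  set e₀ := segment ℝ v (v + ℓ 0 • α 0) with he₀
  set e₁ := segment ℝ v (v + ℓ 1 • α 1) with he₁
  have h₀ := ((hvert e₀).2 (Or.inl rfl)).1
  have h₁ := ((hvert e₁).2 (Or.inr rfl)).1
  have hcor : IsPlaneCorner Δ v (α 0) (α 1) (ℓ 0) (ℓ 1) δ φ ψ :=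
    ⟨hconv, hcoord, hδ, hℓ 0, hℓ 1, h₀.2, h₁.2⟩
  have hset : {x | ∃ s : Fin 2 → ℝ, x = v + ∑ j, s j • α j ∧ δ ≤ ∑ j, s j} =
      {x | δ ≤ φ (x - v) + ψ (x - v)} := by
    ext x
    simp only [Fin.sum_univ_two, Set.mem_ofPred_eq]
    constructor
    · rintro ⟨s, rfl, hs⟩
      simpa [hcoord.fst_left, hcoord.fst_right, hcoord.snd_left, hcoord.snd_right] using hs
    · intro hx
      exact ⟨![φ (x - v), ψ (x - v)], by simpa [add_assoc] using hcor.eq_add x, by simpa using hx⟩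
  rw [hset]
  have hiff := hcor.isEdge_inter_iff hc fun e he hv => (hvert e).1 ⟨he, hv⟩
  set c := segment ℝ (v + δ • α 0) (v + δ • α 1) with hcdef
  set t₀ := segment ℝ (v + δ • α 0) (v + ℓ 0 • α 0) with ht₀
  set t₁ := segment ℝ (v + δ • α 1) (v + ℓ 1 • α 1) with ht₁
  have hv_notMem : ∀ e, IsEdge (Δ ∩ {x | δ ≤ φ (x - v) + ψ (x - v)}) e → v ∉ e := by
    intro e he hv
    have : δ ≤ φ (v - v) + ψ (v - v) := (he.2.subset hv).2
    simp only [sub_self, map_zero, add_zero] at this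
    linarith
  have hcne : ¬ IsEdge Δ c := fun he =>
    hv_notMem c ((hiff c).2 (Or.inl rfl)) (hcor.vertex_mem he.2 (left_mem_segment ℝ _ _))
  have ht₀ne : ¬ IsEdge Δ t₀ := fun he => hv_notMem t₀ ((hiff t₀).2 (Or.inr (Or.inl rfl)))
    (hcor.vertex_mem he.2 (left_mem_segment ℝ _ _))
  have ht₁ne : ¬ IsEdge Δ t₁ := fun he => hv_notMem t₁ ((hiff t₁).2 (Or.inr (Or.inr (Or.inl rfl))))
    (hcor.swap.vertex_mem he.2 (left_mem_segment ℝ _ _))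
  have hφe₁ : ∀ x ∈ e₁, φ (x - v) = 0 := fun x hx => hcor.fst_eq_zero hx
  have hℓ₀ : 0 < ℓ 0 := hδ.trans (hℓ 0)
  have hℓ₁ : 0 < ℓ 1 := hδ.trans (hℓ 1)
  have hφ : ∀ s : ℝ, φ (v + s • α 0 - v) = s := fun s => by simp [hcoord.fst_left]
  have ht₁e₁ : t₁ ⊆ e₁ := (convex_segment _ _).segment_subset
    (hcor.swap.mem_left hδ.le (hℓ 1).le) (right_mem_segment ℝ _ _)
  have he₀₁ : e₀ ≠ e₁ := fun he => by
    have := hφe₁ (v + ℓ 0 • α 0) (he ▸ right_mem_segment ℝ _ _)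
    rw [hφ] at this
    linarith
  have ht₀₁ : t₀ ≠ t₁ := fun he => by
    have := hφe₁ (v + ℓ 0 • α 0) (ht₁e₁ (he ▸ right_mem_segment ℝ _ _))
    rw [hφ] at this
    linarith
  have hct₁ : c ≠ t₁ := fun he => by
    have := hφe₁ (v + δ • α 0) (ht₁e₁ (he ▸ left_mem_segment ℝ _ _))
    rw [hφ] at this
    linarith
  have hct₀ : c ≠ t₀ := fun he => by
    have h1 : v + ℓ 0 • α 0 ∈ c := he ▸ right_mem_segment ℝ _ _
    rw [hcdef, ← hcor.inter_line] at h1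
    have h2 : φ (v + ℓ 0 • α 0 - v) + ψ (v + ℓ 0 • α 0 - v) = δ := h1.2
    have h3 := hℓ 0
    rw [hφ, add_sub_cancel_left, map_smul, hcoord.snd_left, smul_zero] at h2
    linarith
  have hA' : IsUnit (A 1 0 * A 0 1 - A 1 1 * A 0 0) := by
    convert hA.neg using 1; ring
  have hlen₀ : len e₀ = ℓ 0 := (hlen e₀ ((hmemE _).2 h₀)).unique
    (ratLength_of_det (v := A 0) (w := A 1) hℓ₀ hA fun i => by simp [hαA])
  have hlen₁ : len e₁ = ℓ 1 := (hlen e₁ ((hmemE _).2 h₁)).unique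
    (ratLength_of_det (v := A 1) (w := A 0) hℓ₁ hA' fun i => by simp [hαA])
  have hlenc : RatLength c δ := by
    refine ratLength_of_det (v := A 1 - A 0) (w := A 0) hδ ?_ fun i => ?_
    · convert hA' using 1
      simp only [Pi.sub_apply]
      ring
    · simp [hαA]
      ring
  have hlent₀ : RatLength t₀ (ℓ 0 - δ) :=
    ratLength_of_det (v := A 0) (w := A 1) (sub_pos.2 (hℓ 0)) hA fun i => by
      simp [hαA]; ring
  have hlent₁ : RatLength t₁ (ℓ 1 - δ) :=
    ratLength_of_det (v := A 1) (w := A 0) (sub_pos.2 (hℓ 1)) hA' fun i => by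
      simp [hαA]; ring
  set R := (E.erase e₀).erase e₁ with hR
  have hmemR : ∀ e, e ∈ R ↔ IsEdge Δ e ∧ v ∉ e := fun e => by
    have := hvert e
    rw [hR, Finset.mem_erase, Finset.mem_erase, hmemE]
    tauto
  have hcR : c ∉ R := fun hm => hcne ((hmemR c).1 hm).1
  have ht₀R : t₀ ∉ R := fun hm => ht₀ne ((hmemR t₀).1 hm).1
  have ht₁R : t₁ ∉ R := fun hm => ht₁ne ((hmemR t₁).1 hm).1
  have hlenR : ∀ e ∈ R, (if e = c then δ else if e = t₀ then ℓ 0 - δ else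
      if e = t₁ then ℓ 1 - δ else len e) = len e := fun e he => by
    rw [if_neg (ne_of_mem_of_not_mem he hcR), if_neg (ne_of_mem_of_not_mem he ht₀R),
      if_neg (ne_of_mem_of_not_mem he ht₁R)]
  refine ⟨insert c (insert t₀ (insert t₁ R)), fun e => if e = c then δ else
    if e = t₀ then ℓ 0 - δ else if e = t₁ then ℓ 1 - δ else len e, ?_, ?_, ?_⟩
  · ext e
    simp only [Finset.coe_insert, Set.mem_insert_iff, Finset.mem_coe, hmemR, Set.mem_ofPred_eq,
      hiff]
  · intro e he
    simp only [Finset.mem_insert] at he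
    rcases he with rfl | rfl | rfl | he
    · simpa using hlenc
    · simpa [hct₀.symm] using hlent₀
    · simpa [hct₁.symm, ht₀₁.symm] using hlent₁
    · simp only [hlenR e he]
      exact hlen e ((hmemE e).2 ((hmemR e).1 he).1)
  · rw [Finset.sum_insert (by simp [hct₀, hct₁, hcR]), Finset.sum_insert (by simp [ht₀₁, ht₀R]),
      Finset.sum_insert ht₁R, Finset.sum_congr rfl hlenR,
      ← Finset.add_sum_erase E len ((hmemE e₀).2 h₀),
      ← Finset.add_sum_erase (E.erase e₀) len
        (Finset.mem_erase.2 ⟨he₀₁.symm, (hmemE e₁).2 h₁⟩), ← hR, hlen₀, hlen₁]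
    simp only [if_true, if_neg hct₀.symm, if_neg hct₁.symm, if_neg ht₀₁.symm]
    ring

lemma HasPerimeter.unique {Δ : Set (Pt 2)} {P Q : ℝ} (hP : HasPerimeter Δ P)
    (hQ : HasPerimeter Δ Q) : P = Q := by
  obtain ⟨E, len, hE, hlen, rfl⟩ := hP
  obtain ⟨E', len', hE', hlen', rfl⟩ := hQ
  obtain rfl : E = E' := Finset.coe_injective (hE.trans hE'.symm)
  exact Finset.sum_congr rfl fun e he => (hlen e he).unique (hlen' e he)

/-- Under a sequence of corner choppings of sizes `δ 0, …, δ (s-1)`, the rational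
perimeter decreases by the sum of the sizes. -/
theorem stmt5 (s : ℕ) (Δ : ℕ → Set (Pt 2)) (δ : ℕ → ℝ)
    (hΔ : ∀ i ≤ s, IsDelzant (Δ i))
    (hchop : ∀ i < s, 0 < δ i ∧ ∃ v, IsCornerChop (Δ i) v (δ i) (Δ (i + 1)))
    (P0 Ps : ℝ) (h0 : HasPerimeter (Δ 0) P0) (hs : HasPerimeter (Δ s) Ps) :
    Ps = P0 - ∑ i ∈ Finset.range s, δ i := by
  have key : ∀ i ≤ s, HasPerimeter (Δ i) (P0 - ∑ j ∈ Finset.range i, δ j) := by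
    intro i
    induction i with
    | zero => intro _; simpa using h0
    | succ i ih =>
      intro hi
      obtain ⟨-, v, hv⟩ := hchop i hi
      have hi' : i ≤ s := (Nat.lt_of_succ_le hi).le
      rw [Finset.sum_range_succ, ← sub_sub]
      exact hv.hasPerimeter (hΔ i hi').1.1 (hΔ i hi').1.2.1 (ih hi')
  exact hs.unique (key s le_rfl)
end

section
/- Let ε > 0 and let m ∈ {2, 3}. There exists a sequence of Delzant polygons Δ⁰, Δ¹, …, Δᵐ with Δ⁰ = Δ₁ (the Delzant triangle of size 1) such that each Δⁱ is obtained from Δⁱ⁻¹ by a corner chopping of size ε, if and only if ε < 1/2. -/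
open Set Finset MeasureTheory

theorem mem_segment_add_iff {E : Type*} [AddCommGroup E] [Module ℝ E] {v d x : E} :
    x ∈ segment ℝ v (v + d) ↔ ∃ θ : ℝ, 0 ≤ θ ∧ θ ≤ 1 ∧ x = v + θ • d := by
  rw [segment_eq_image']
  constructor
  · rintro ⟨θ, ⟨h0, h1⟩, rfl⟩
    exact ⟨θ, h0, h1, by simp⟩
  · rintro ⟨θ, h0, h1, rfl⟩
    exact ⟨θ, ⟨h0, h1⟩, by simp⟩

theorem segment_add_injective {E : Type*} [AddCommGroup E] [Module ℝ E] {v d d' : E}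
    (h : segment ℝ v (v + d) = segment ℝ v (v + d')) : d = d' := by
  obtain ⟨θ, h0, h1, hd⟩ := mem_segment_add_iff.1 (h ▸ right_mem_segment ℝ v (v + d))
  obtain ⟨η, k0, k1, hd'⟩ := mem_segment_add_iff.1 (h.symm ▸ right_mem_segment ℝ v (v + d'))
  have e1 : d = θ • d' := add_left_cancel hd
  have e2 : d' = η • d := add_left_cancel hd'
  have e3 : (1 - θ * η) • d = 0 := by
    rw [sub_smul, one_smul, mul_smul, ← e2, ← e1, sub_self]
  rcases smul_eq_zero.1 e3 with hθ | hd0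
  · have : θ = 1 := by nlinarith
    rw [e1, this, one_smul]
  · rw [e2, hd0, smul_zero]

/-- Each vector of a lattice basis takes the value one under some integral functional. -/
theorem IsLatticeBasis.exists_dual {n : ℕ} {α : Fin n → Pt n} (h : IsLatticeBasis α) (j : Fin n) :
    ∃ c : Fin n → ℤ, ∑ i, α j i * (c i : ℝ) = 1 := by
  obtain ⟨A, hA, hα⟩ := h
  refine ⟨fun i => A⁻¹ i j, ?_⟩
  have := congrFun (congrFun (Matrix.mul_nonsing_inv A hA) j) j
  rw [Matrix.mul_apply, Matrix.one_apply_eq] at this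
  simp only [hα]
  exact_mod_cast this

/-- Members of lattice bases are primitive, so each determines its positive multiples. -/
theorem IsLatticeBasis.eq_of_smul_eq {n : ℕ} {α β : Fin n → Pt n} (hα : IsLatticeBasis α)
    (hβ : IsLatticeBasis β) {i j : Fin n} {l m : ℝ} (hl : 0 < l) (hm : 0 < m)
    (h : l • α i = m • β j) : l = m ∧ α i = β j := by
  obtain ⟨c, hc⟩ := hα.exists_dual i
  obtain ⟨d, hd⟩ := hβ.exists_dual j
  obtain ⟨A, -, hA⟩ := hα
  obtain ⟨B, -, hB⟩ := hβ
  have key : ∀ f : Fin n → ℤ, l * ∑ k, α i k * (f k : ℝ) = m * ∑ k, β j k * (f k : ℝ) := by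
    intro f
    rw [Finset.mul_sum, Finset.mul_sum]
    refine Finset.sum_congr rfl fun k _ => ?_
    have := congrFun h k
    simp only [Pi.smul_apply, smul_eq_mul] at this
    rw [← mul_assoc, this, mul_assoc]
  obtain ⟨N, hN⟩ : ∃ N : ℤ, ∑ k, β j k * (c k : ℝ) = N :=
    ⟨∑ k, B j k * c k, by simp [hB]⟩
  obtain ⟨M, hM⟩ : ∃ M : ℤ, ∑ k, α i k * (d k : ℝ) = M :=
    ⟨∑ k, A i k * d k, by simp [hA]⟩
  have k1 := key c
  have k2 := key d
  rw [hc, hN, mul_one] at k1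
  rw [hd, hM, mul_one] at k2
  have hNpos : (0 : ℝ) < N := by
    by_contra! hneg
    nlinarith
  have hMpos : (0 : ℝ) < M := by
    by_contra! hneg
    nlinarith
  have hN1 : (1 : ℝ) ≤ N := by exact_mod_cast (Int.cast_pos.1 hNpos : 0 < N)
  have hM1 : (1 : ℝ) ≤ M := by exact_mod_cast (Int.cast_pos.1 hMpos : 0 < M)
  have hlm : l = m := by nlinarith
  refine ⟨hlm, ?_⟩
  rw [hlm] at h
  exact smul_right_injective _ hm.ne' h

theorem IsLatticeBasis.linearIndependent {n : ℕ} {α : Fin n → Pt n} (h : IsLatticeBasis α) :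
    LinearIndependent ℝ α := by
  obtain ⟨A, hA, hα⟩ := h
  have : α = (A.map (Int.castRingHom ℝ)).row := by
    ext j i
    simp [hα]
  have hdet : (A.map (Int.castRingHom ℝ)).det ≠ 0 := by
    rw [← RingHom.mapMatrix_apply, ← RingHom.map_det]
    exact (hA.map (Int.castRingHom ℝ)).ne_zero
  rw [this]
  exact Matrix.linearIndependent_rows_of_det_ne_zero hdet

theorem isLatticeBasis_pair {p q : Pt 2} {a b c d : ℤ} (hp : p = ![(a : ℝ), b])
    (hq : q = ![(c : ℝ), d]) (h : a * d - b * c = 1 ∨ a * d - b * c = -1) :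
    IsLatticeBasis ![p, q] := by
  refine ⟨!![a, b; c, d], ?_, ?_⟩
  · rw [Matrix.det_fin_two_of, Int.isUnit_iff]
    exact h
  · intro j i
    subst hp hq
    fin_cases j <;> fin_cases i <;> simp

/-- `Δ` is a convex set with a smooth corner at `v`, with primitive edge vectors `p`, `q` and edge
lengths `l`, `m`. -/
structure HasDelzantCorner (Δ : Set (Pt 2)) (v p q : Pt 2) (l m : ℝ) : Prop where
  convex : Convex ℝ Δ
  basis : IsLatticeBasis ![p, q]
  left_pos : 0 < l
  right_pos : 0 < m
  mem : v ∈ Δ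
  cone : ∀ x ∈ Δ, ∃ s t : ℝ, 0 ≤ s ∧ 0 ≤ t ∧ x = v + s • p + t • q
  left_mem : v + l • p ∈ Δ
  right_mem : v + m • q ∈ Δ
  left_le : ∀ s : ℝ, v + s • p ∈ Δ → s ≤ l
  right_le : ∀ t : ℝ, v + t • q ∈ Δ → t ≤ m

namespace HasDelzantCorner

variable {Δ : Set (Pt 2)} {v p q : Pt 2} {l m : ℝ}

theorem symm (h : HasDelzantCorner Δ v p q l m) : HasDelzantCorner Δ v q p m l where
  convex := h.convex
  basis := by
    obtain ⟨A, hA, hα⟩ := h.basis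
    refine ⟨A.submatrix (Equiv.swap 0 1) id, ?_, ?_⟩
    · rw [Matrix.det_permute]
      exact (Units.isUnit _).mul hA
    · intro j i
      fin_cases j
      · exact hα 1 i
      · exact hα 0 i
  left_pos := h.right_pos
  right_pos := h.left_pos
  mem := h.mem
  cone x hx := by
    obtain ⟨s, t, hs, ht, rfl⟩ := h.cone x hx
    exact ⟨t, s, ht, hs, by abel⟩
  left_mem := h.right_mem
  right_mem := h.left_mem
  left_le := h.right_le
  right_le := h.left_le

theorem coord_ext (h : HasDelzantCorner Δ v p q l m) {s t s' t' : ℝ}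
    (e : s • p + t • q = s' • p + t' • q) : s = s' ∧ t = t' := by
  have := LinearIndependent.pair_iff.1 h.basis.linearIndependent (s - s') (t - t') (by
    rw [sub_smul, sub_smul, sub_add_sub_comm, e, sub_self])
  exact ⟨sub_eq_zero.1 this.1, sub_eq_zero.1 this.2⟩

theorem ne_zero (h : HasDelzantCorner Δ v p q l m) : p ≠ 0 := by
  rintro rfl
  have := h.coord_ext (s := 1) (t := 0) (s' := 0) (t' := 0) (by simp)
  norm_num at this

theorem ray_mem (h : HasDelzantCorner Δ v p q l m) {s : ℝ} (hs : 0 ≤ s) (hsl : s ≤ l) :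
    v + s • p ∈ Δ := by
  refine h.convex.segment_subset h.mem h.left_mem
    (mem_segment_add_iff.2 ⟨s / l, div_nonneg hs h.left_pos.le,
      (div_le_one h.left_pos).2 hsl, ?_⟩)
  rw [smul_smul, div_mul_cancel₀ _ h.left_pos.ne']

theorem isEdge_left (h : HasDelzantCorner Δ v p q l m) : IsEdge Δ (segment ℝ v (v + l • p)) := by
  refine ⟨⟨v, v + l • p, ?_, rfl⟩, h.convex.segment_subset h.mem h.left_mem, ?_⟩
  · intro e
    exact smul_ne_zero h.left_pos.ne' h.ne_zero (left_eq_add.1 e)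
  · rintro x hx y hy z hz ⟨a, b, ha, hb, hab, hxy⟩
    obtain ⟨θ, -, -, rfl⟩ := mem_segment_add_iff.1 hz
    obtain ⟨s, t, hs, ht, rfl⟩ := h.cone x hx
    obtain ⟨s', t', hs', ht', rfl⟩ := h.cone y hy
    have e : (a * s + b * s') • p + (a * t + b * t') • q = (θ * l) • p + (0 : ℝ) • q := by
      have hb' : b = 1 - a := by linarith
      subst hb'
      apply add_left_cancel (a := v)
      rw [zero_smul, add_zero, ← smul_smul, ← hxy]
      module
    have e2 := (h.coord_ext e).2
    have ht0 : t = 0 := by nlinarith [mul_nonneg ha.le ht, mul_nonneg hb.le ht']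
    subst ht0
    have hx' : v + s • p ∈ Δ := by simpa using hx
    refine mem_segment_add_iff.2 ⟨s / l, div_nonneg hs h.left_pos.le,
      (div_le_one h.left_pos).2 (h.left_le s hx'), ?_⟩
    rw [smul_smul, div_mul_cancel₀ _ h.left_pos.ne', zero_smul, add_zero]

theorem mem_extremePoints (h : HasDelzantCorner Δ v p q l m) : v ∈ Δ.extremePoints ℝ := by
  refine ⟨h.mem, ?_⟩
  rintro x hx y hy ⟨a, b, ha, hb, hab, hxy⟩
  obtain ⟨s, t, hs, ht, rfl⟩ := h.cone x hx
  obtain ⟨s', t', hs', ht', rfl⟩ := h.cone y hy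
  have e : (a * s + b * s') • p + (a * t + b * t') • q = (0 : ℝ) • p + (0 : ℝ) • q := by
    have hb' : b = 1 - a := by linarith
    subst hb'
    apply add_left_cancel (a := v)
    rw [zero_smul, zero_smul, add_zero, add_zero]
    conv_rhs => rw [← hxy]
    module
  obtain ⟨e1, e2⟩ := h.coord_ext e
  have hs0 : s = 0 := by nlinarith [mul_nonneg ha.le hs, mul_nonneg hb.le hs']
  have ht0 : t = 0 := by nlinarith [mul_nonneg ha.le ht, mul_nonneg hb.le ht']
  simp [hs0, ht0]

theorem eq_left_of_isExtreme (h : HasDelzantCorner Δ v p q l m) {s : ℝ} (hs : 0 ≤ s)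
    (hne : v ≠ v + s • p) (he : IsExtreme ℝ Δ (segment ℝ v (v + s • p))) : s = l := by
  have hs0 : 0 < s := by
    refine lt_of_le_of_ne hs ?_
    rintro rfl
    simp at hne
  have hsl := h.left_le s (he.subset (right_mem_segment ℝ _ _))
  by_contra hsne
  have hlt : s < l := lt_of_le_of_ne hsl hsne
  have hl := h.left_pos
  have hmem : v + l • p ∈ segment ℝ v (v + s • p) := by
    refine he.left_mem_of_mem_openSegment h.left_mem h.mem (right_mem_segment ℝ _ _)
      ⟨s / l, 1 - s / l, by positivity, sub_pos.2 ((div_lt_one hl).2 hlt), by ring, ?_⟩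
    have : s • p = (s / l) • l • p := by rw [smul_smul, div_mul_cancel₀ _ hl.ne']
    rw [this]
    module
  obtain ⟨θ, h0, h1, e⟩ := mem_segment_add_iff.1 hmem
  have e' : l • p + (0 : ℝ) • q = (θ * s) • p + (0 : ℝ) • q := by
    rw [mul_smul, add_left_cancel e]
  have := (h.coord_ext e').1
  nlinarith

theorem eq_zero_or_eq_zero_of_isExtreme (h : HasDelzantCorner Δ v p q l m) {s t : ℝ} (hs : 0 ≤ s)
    (ht : 0 ≤ t) (he : IsExtreme ℝ Δ (segment ℝ v (v + (s • p + t • q)))) : s = 0 ∨ t = 0 := by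
  by_contra! hne
  have hs0 : 0 < s := lt_of_le_of_ne hs hne.1.symm
  have ht0 : 0 < t := lt_of_le_of_ne ht hne.2.symm
  have hl := h.left_pos
  have hm := h.right_pos
  obtain ⟨r, hr, hr1, hrl, hrm⟩ : ∃ r : ℝ, 0 < r ∧ r ≤ 1 ∧ r ≤ l / (2 * s) ∧ r ≤ m / (2 * t) :=
    ⟨min 1 (min (l / (2 * s)) (m / (2 * t))), by positivity, min_le_left _ _,
      (min_le_right _ _).trans (min_le_left _ _), (min_le_right _ _).trans (min_le_right _ _)⟩
  rw [le_div_iff₀ (by positivity)] at hrl hrm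
  have h1 := h.ray_mem (s := r * (2 * s)) (by positivity) hrl
  have h2 := h.symm.ray_mem (s := r * (2 * t)) (by positivity) hrm
  have hmem := he.left_mem_of_mem_openSegment h1 h2
    (z := v + r • (s • p + t • q)) (mem_segment_add_iff.2 ⟨r, hr.le, hr1, rfl⟩)
    ⟨1 / 2, 1 / 2, by norm_num, by norm_num, by norm_num, by module⟩
  obtain ⟨θ, -, -, e⟩ := mem_segment_add_iff.1 hmem
  have e' : (r * (2 * s)) • p + (0 : ℝ) • q = (θ * s) • p + (θ * t) • q := by
    rw [zero_smul, add_zero, add_left_cancel e]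
    module
  obtain ⟨e1, e2⟩ := h.coord_ext e'
  have hθ : θ = 0 := by
    rcases mul_eq_zero.1 e2.symm with h | h
    · exact h
    · exact absurd h ht0.ne'
  rw [hθ, zero_mul] at e1
  have : 0 < r * (2 * s) := by positivity
  linarith

theorem edge_eq (h : HasDelzantCorner Δ v p q l m) {e : Set (Pt 2)} (he : IsEdge Δ e) (hv : v ∈ e) :
    e = segment ℝ v (v + l • p) ∨ e = segment ℝ v (v + m • q) := by
  obtain ⟨w, hvw, rfl⟩ : ∃ w, v ≠ w ∧ e = segment ℝ v w := by
    obtain ⟨⟨c, d, hcd, rfl⟩, hext⟩ := he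
    rcases (mem_extremePoints_iff_forall_segment.1 h.mem_extremePoints).2 c
      (hext.subset (left_mem_segment ℝ _ _)) d (hext.subset (right_mem_segment ℝ _ _)) hv
      with rfl | rfl
    · exact ⟨d, hcd, rfl⟩
    · exact ⟨c, hcd.symm, segment_symm ℝ _ _⟩
  have hext := he.2
  obtain ⟨s, t, hs, ht, rfl⟩ := h.cone w (hext.subset (right_mem_segment ℝ _ _))
  rw [add_assoc] at hext hvw ⊢
  rcases h.eq_zero_or_eq_zero_of_isExtreme hs ht hext with rfl | rfl
  · rw [zero_smul, zero_add] at hext hvw ⊢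
    rw [h.symm.eq_left_of_isExtreme ht hvw hext]
    exact Or.inr rfl
  · rw [zero_smul, add_zero] at hext hvw ⊢
    rw [h.eq_left_of_isExtreme hs hvw hext]
    exact Or.inl rfl

theorem setOf_isEdge (h : HasDelzantCorner Δ v p q l m) : {e | IsEdge Δ e ∧ v ∈ e} =
    {e | ∃ j : Fin 2, e = segment ℝ v (v + ![l, m] j • ![p, q] j)} := by
  ext e
  simp only [mem_ofPred_eq, Fin.exists_fin_two, Matrix.cons_val_zero, Matrix.cons_val_one]
  constructor
  · rintro ⟨he, hv⟩
    exact h.edge_eq he hv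
  · rintro (rfl | rfl)
    · exact ⟨h.isEdge_left, left_mem_segment ℝ _ _⟩
    · exact ⟨h.symm.isEdge_left, left_mem_segment ℝ _ _⟩

theorem delzantAt (h : HasDelzantCorner Δ v p q l m) : DelzantAt Δ v :=
  ⟨![p, q], ![l, m], h.basis, by simp [Fin.forall_fin_two, h.left_pos, h.right_pos],
    h.setOf_isEdge⟩

theorem isCornerChop (h : HasDelzantCorner Δ v p q l m) {δ : ℝ} (hδ : 0 < δ) (hl : δ < l) (hm : δ < m) :
    IsCornerChop Δ v δ (Δ ∩ {x | ∃ s t : ℝ, x = v + s • p + t • q ∧ δ ≤ s + t}) := by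
  refine ⟨h.mem_extremePoints, hδ, ![p, q], ![l, m], h.basis,
    by simp [Fin.forall_fin_two, hl, hm], h.setOf_isEdge, ?_⟩
  congr 1
  ext x
  constructor
  · rintro ⟨s, t, rfl, hst⟩
    exact ⟨![s, t], by simp [add_assoc], by simpa using hst⟩
  · rintro ⟨s, rfl, hst⟩
    exact ⟨s 0, s 1, by simp [add_assoc], by simpa using hst⟩

/-- The edge lengths at a corner, and the result of chopping it, do not depend on the data
witnessing the chopping. -/
theorem of_isCornerChop (h : HasDelzantCorner Δ v p q l m) {δ : ℝ} {Δ' : Set (Pt 2)}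
    (hc : IsCornerChop Δ v δ Δ') :
    δ < l ∧ δ < m ∧ Δ' = Δ ∩ {x | ∃ s t : ℝ, x = v + s • p + t • q ∧ δ ≤ s + t} := by
  obtain ⟨-, hδ, α, ℓ, hα, hℓ, hedge, rfl⟩ := hc
  rw [h.setOf_isEdge] at hedge
  have hpos : ∀ j : Fin 2, 0 < ![l, m] j := by
    simp [Fin.forall_fin_two, h.left_pos, h.right_pos]
  have key : ∀ j, ∃ i : Fin 2, ℓ j = ![l, m] i ∧ α j = ![p, q] i := by
    intro j
    have hj : segment ℝ v (v + ℓ j • α j) ∈ {e | ∃ j, e = segment ℝ v (v + ℓ j • α j)} := ⟨j, rfl⟩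
    rw [← hedge] at hj
    obtain ⟨i, hi⟩ := hj
    exact ⟨i, hα.eq_of_smul_eq h.basis (hδ.trans (hℓ j)) (hpos i) (segment_add_injective hi)⟩
  have hne : α 0 ≠ α 1 := fun e => by
    simpa using hα.linearIndependent.injective e
  have hℓ0 := hℓ 0
  have hℓ1 := hℓ 1
  have hset : {x | ∃ s : Fin 2 → ℝ, x = v + ∑ j, s j • α j ∧ δ ≤ ∑ j, s j} =
      {x | ∃ s t : ℝ, x = v + s • α 0 + t • α 1 ∧ δ ≤ s + t} := by
    ext x
    constructor
    · rintro ⟨s, rfl, hst⟩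
      exact ⟨s 0, s 1, by simp [add_assoc], by simpa using hst⟩
    · rintro ⟨s, t, rfl, hst⟩
      exact ⟨![s, t], by simp [add_assoc], by simpa using hst⟩
  rw [hset]
  obtain ⟨i, hi, hi'⟩ := key 0
  obtain ⟨j, hj, hj'⟩ := key 1
  rw [hi', hj'] at hne ⊢
  rw [hi] at hℓ0
  rw [hj] at hℓ1
  fin_cases i <;> fin_cases j
  · exact absurd rfl hne
  · exact ⟨hℓ0, hℓ1, rfl⟩
  · refine ⟨hℓ1, hℓ0, ?_⟩
    congr 1
    ext x
    constructor
    · rintro ⟨s, t, rfl, hst⟩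
      exact ⟨t, s, add_right_comm _ _ _, by linarith⟩
    · rintro ⟨s, t, rfl, hst⟩
      exact ⟨t, s, add_right_comm _ _ _, by linarith⟩
  · exact absurd rfl hne

end HasDelzantCorner

/-- The triangle of size one with its corners `(0, 0)`, `(1, 0)`, `(0, 1)` cut off at the respective
depths `a`, `b`, `c`. -/
def choppedTriangle (a b c : ℝ) : Set (Pt 2) :=
  {x | (0 ≤ x 0 ∧ x 0 ≤ 1 - b) ∧ (0 ≤ x 1 ∧ x 1 ≤ 1 - c) ∧ a ≤ x 0 + x 1 ∧ x 0 + x 1 ≤ 1}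

theorem mem_choppedTriangle {a b c : ℝ} {x : Pt 2} : x ∈ choppedTriangle a b c ↔
    (0 ≤ x 0 ∧ x 0 ≤ 1 - b) ∧ (0 ≤ x 1 ∧ x 1 ≤ 1 - c) ∧ a ≤ x 0 + x 1 ∧ x 0 + x 1 ≤ 1 :=
  Iff.rfl

theorem choppedTriangle_zero : choppedTriangle 0 0 0 = DelzantTriangle 1 := by
  ext x
  rw [mem_choppedTriangle]
  constructor
  · rintro ⟨⟨h1, h2⟩, ⟨h3, h4⟩, h5, h6⟩
    exact ⟨h1, h3, h6⟩
  · rintro ⟨h1, h2, h3⟩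
    refine ⟨⟨h1, ?_⟩, ⟨h2, ?_⟩, ?_, h3⟩ <;> linarith

theorem isClosed_choppedTriangle (a b c : ℝ) : IsClosed (choppedTriangle a b c) := by
  simp only [choppedTriangle, ofPred_and]
  refine .inter (.inter ?_ ?_) (.inter (.inter ?_ ?_) (.inter ?_ ?_)) <;>
    exact isClosed_le (by fun_prop) (by fun_prop)

theorem convex_choppedTriangle (a b c : ℝ) : Convex ℝ (choppedTriangle a b c) := by
  rintro x ⟨⟨h1, h2⟩, ⟨h3, h4⟩, h5, h6⟩ y ⟨⟨k1, k2⟩, ⟨k3, k4⟩, k5, k6⟩ s t hs ht hst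
  obtain rfl : t = 1 - s := by linarith
  simp only [mem_choppedTriangle, Pi.add_apply, Pi.smul_apply, smul_eq_mul]
  refine ⟨⟨?_, ?_⟩, ⟨?_, ?_⟩, ?_, ?_⟩ <;> nlinarith

theorem isCompact_choppedTriangle {a b c : ℝ} (hb : 0 ≤ b) (hc : 0 ≤ c) :
    IsCompact (choppedTriangle a b c) := by
  refine (isCompact_Icc (a := (0 : Pt 2)) (b := 1)).of_isClosed_subset
    (isClosed_choppedTriangle a b c) ?_
  rintro x ⟨⟨h1, h2⟩, ⟨h3, h4⟩, -, -⟩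
  refine ⟨fun i => ?_, fun i => ?_⟩ <;> fin_cases i <;> simp <;> linarith

theorem interior_choppedTriangle_nonempty {a b c : ℝ} (ha : a < 2 / 3) (hb : b < 2 / 3)
    (hc : c < 2 / 3) : (interior (choppedTriangle a b c)).Nonempty := by
  refine ⟨![1 / 3, 1 / 3], mem_interior.2 ⟨{x | (0 < x 0 ∧ x 0 < 1 - b) ∧
    (0 < x 1 ∧ x 1 < 1 - c) ∧ a < x 0 + x 1 ∧ x 0 + x 1 < 1}, ?_, ?_, ?_⟩⟩
  · rintro x ⟨⟨h1, h2⟩, ⟨h3, h4⟩, h5, h6⟩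
    exact ⟨⟨h1.le, h2.le⟩, ⟨h3.le, h4.le⟩, h5.le, h6.le⟩
  · simp only [ofPred_and]
    refine .inter (.inter ?_ ?_) (.inter (.inter ?_ ?_) (.inter ?_ ?_)) <;>
      exact isOpen_lt (by fun_prop) (by fun_prop)
  · simp only [mem_ofPred_eq, Matrix.cons_val_zero, Matrix.cons_val_one]
    refine ⟨⟨?_, ?_⟩, ⟨?_, ?_⟩, ?_, ?_⟩ <;> linarith

theorem hasDelzantCorner_choppedTriangle {a b c v₀ v₁ l m : ℝ} {p₀ p₁ q₀ q₁ : ℤ}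
    (hdet : p₀ * q₁ - p₁ * q₀ = 1) (hl : 0 < l) (hm : 0 < m)
    (hv : ![v₀, v₁] ∈ choppedTriangle a b c)
    (hp : ![v₀ + l * p₀, v₁ + l * p₁] ∈ choppedTriangle a b c)
    (hq : ![v₀ + m * q₀, v₁ + m * q₁] ∈ choppedTriangle a b c)
    (hcone : ∀ x ∈ choppedTriangle a b c, 0 ≤ (x 0 - v₀) * q₁ - (x 1 - v₁) * q₀ ∧
      0 ≤ p₀ * (x 1 - v₁) - p₁ * (x 0 - v₀))
    (hpl : ∀ s : ℝ, ![v₀ + s * p₀, v₁ + s * p₁] ∈ choppedTriangle a b c → s ≤ l)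
    (hqm : ∀ t : ℝ, ![v₀ + t * q₀, v₁ + t * q₁] ∈ choppedTriangle a b c → t ≤ m) :
    HasDelzantCorner (choppedTriangle a b c) ![v₀, v₁] ![(p₀ : ℝ), p₁] ![(q₀ : ℝ), q₁] l m where
  convex := convex_choppedTriangle a b c
  basis := isLatticeBasis_pair rfl rfl (Or.inl hdet)
  left_pos := hl
  right_pos := hm
  mem := hv
  cone x hx := by
    have hdet' : (p₀ * q₁ - p₁ * q₀ : ℝ) = 1 := by exact_mod_cast hdet
    refine ⟨_, _, (hcone x hx).1, (hcone x hx).2, ?_⟩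
    ext i
    fin_cases i <;> simp
    · linear_combination (v₀ - x 0) * hdet'
    · linear_combination (v₁ - x 1) * hdet'
  left_mem := by simpa using hp
  right_mem := by simpa using hq
  left_le s hs := hpl s (by simpa using hs)
  right_le t ht := hqm t (by simpa using ht)

theorem eq_zero_of_mem_extremePoints {E : Type*} [AddCommGroup E] [Module ℝ E] {A : Set E}
    {x d : E} (hx : x ∈ A.extremePoints ℝ) (h1 : x + d ∈ A) (h2 : x - d ∈ A) : d = 0 :=
  add_eq_left.1 (hx.2 h1 h2 ⟨1 / 2, 1 / 2, by norm_num, by norm_num, by norm_num, by module⟩)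

section corners

variable {a b c δ : ℝ}

theorem hasDelzantCorner_origin (hb0 : 0 ≤ b) (hc0 : 0 ≤ c) (hb : b < 1) (hc : c < 1) :
    HasDelzantCorner (choppedTriangle 0 b c) ![0, 0] ![((1 : ℤ) : ℝ), (0 : ℤ)]
      ![((0 : ℤ) : ℝ), (1 : ℤ)] (1 - b) (1 - c) := by
  apply hasDelzantCorner_choppedTriangle <;> simp [mem_choppedTriangle] <;> grind

theorem hasDelzantCorner_right (ha0 : 0 ≤ a) (hc0 : 0 ≤ c) (ha : a < 1) (hc : c < 1) :
    HasDelzantCorner (choppedTriangle a 0 c) ![1, 0] ![((-1 : ℤ) : ℝ), (1 : ℤ)]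
      ![((-1 : ℤ) : ℝ), (0 : ℤ)] (1 - c) (1 - a) := by
  apply hasDelzantCorner_choppedTriangle <;> simp [mem_choppedTriangle] <;> grind

theorem hasDelzantCorner_top (ha0 : 0 ≤ a) (hb0 : 0 ≤ b) (ha : a < 1) (hb : b < 1) :
    HasDelzantCorner (choppedTriangle a b 0) ![0, 1] ![((0 : ℤ) : ℝ), (-1 : ℤ)]
      ![((1 : ℤ) : ℝ), (-1 : ℤ)] (1 - a) (1 - b) := by
  apply hasDelzantCorner_choppedTriangle <;> simp [mem_choppedTriangle] <;> grind

theorem hasDelzantCorner_origin_right (ha : 0 < a) (hb : 0 ≤ b) (hab : a + b < 1)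
    (hac : a + c < 1) :
    HasDelzantCorner (choppedTriangle a b c) ![a, 0] ![((1 : ℤ) : ℝ), (0 : ℤ)]
      ![((-1 : ℤ) : ℝ), (1 : ℤ)] (1 - a - b) a := by
  apply hasDelzantCorner_choppedTriangle <;> (try simp [mem_choppedTriangle]) <;> grind

theorem hasDelzantCorner_origin_top (ha : 0 < a) (hb : 0 ≤ b) (hc : 0 ≤ c) (hab : a + b < 1)
    (hac : a + c < 1) :
    HasDelzantCorner (choppedTriangle a b c) ![0, a] ![((1 : ℤ) : ℝ), (-1 : ℤ)]
      ![((0 : ℤ) : ℝ), (1 : ℤ)] a (1 - a - c) := by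
  apply hasDelzantCorner_choppedTriangle <;> (try simp [mem_choppedTriangle]) <;> grind

theorem hasDelzantCorner_right_origin (ha : 0 ≤ a) (hb : 0 < b) (hab : a + b < 1)
    (hbc : b + c < 1) :
    HasDelzantCorner (choppedTriangle a b c) ![1 - b, 0] ![((0 : ℤ) : ℝ), (1 : ℤ)]
      ![((-1 : ℤ) : ℝ), (0 : ℤ)] b (1 - a - b) := by
  apply hasDelzantCorner_choppedTriangle <;> (try simp [mem_choppedTriangle]) <;> grind

theorem hasDelzantCorner_right_top (ha : 0 ≤ a) (hb : 0 < b) (hc : 0 ≤ c) (hab : a + b < 1)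
    (hbc : b + c < 1) :
    HasDelzantCorner (choppedTriangle a b c) ![1 - b, b] ![((-1 : ℤ) : ℝ), (1 : ℤ)]
      ![((0 : ℤ) : ℝ), (-1 : ℤ)] (1 - b - c) b := by
  apply hasDelzantCorner_choppedTriangle <;> (try simp [mem_choppedTriangle]) <;> grind

theorem hasDelzantCorner_top_origin (ha : 0 ≤ a) (hc : 0 < c) (hac : a + c < 1)
    (hbc : b + c < 1) :
    HasDelzantCorner (choppedTriangle a b c) ![0, 1 - c] ![((0 : ℤ) : ℝ), (-1 : ℤ)]
      ![((1 : ℤ) : ℝ), (0 : ℤ)] (1 - a - c) c := by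
  apply hasDelzantCorner_choppedTriangle <;> (try simp [mem_choppedTriangle]) <;> grind

theorem hasDelzantCorner_top_right (ha : 0 ≤ a) (hb : 0 ≤ b) (hc : 0 < c) (hac : a + c < 1)
    (hbc : b + c < 1) :
    HasDelzantCorner (choppedTriangle a b c) ![c, 1 - c] ![((-1 : ℤ) : ℝ), (0 : ℤ)]
      ![((1 : ℤ) : ℝ), (-1 : ℤ)] c (1 - b - c) := by
  apply hasDelzantCorner_choppedTriangle <;> (try simp [mem_choppedTriangle]) <;> grind

theorem chop_origin (hδ : 0 ≤ δ) :
    choppedTriangle 0 b c ∩ {x | ∃ s t : ℝ, x = ![0, 0] + s • ![((1 : ℤ) : ℝ), (0 : ℤ)] +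
      t • ![((0 : ℤ) : ℝ), (1 : ℤ)] ∧ δ ≤ s + t} = choppedTriangle δ b c := by
  ext x
  simp only [mem_inter_iff, mem_choppedTriangle, mem_ofPred_eq]
  constructor
  · rintro ⟨hx, s, t, rfl, hst⟩
    simp at hx ⊢
    grind
  · rintro hx
    refine ⟨by grind, x 0, x 1, ?_, by grind⟩
    ext i
    fin_cases i <;> simp

theorem chop_right (hδ : 0 ≤ δ) :
    choppedTriangle a 0 c ∩ {x | ∃ s t : ℝ, x = ![1, 0] + s • ![((-1 : ℤ) : ℝ), (1 : ℤ)] +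
      t • ![((-1 : ℤ) : ℝ), (0 : ℤ)] ∧ δ ≤ s + t} = choppedTriangle a δ c := by
  ext x
  simp only [mem_inter_iff, mem_choppedTriangle, mem_ofPred_eq]
  constructor
  · rintro ⟨hx, s, t, rfl, hst⟩
    simp at hx ⊢
    grind
  · rintro hx
    refine ⟨by grind, x 1, 1 - x 0 - x 1, ?_, by grind⟩
    ext i
    fin_cases i <;> simp
    ring

theorem chop_top :
    choppedTriangle a b 0 ∩ {x | ∃ s t : ℝ, x = ![0, 1] + s • ![((0 : ℤ) : ℝ), (-1 : ℤ)] +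
      t • ![((1 : ℤ) : ℝ), (-1 : ℤ)] ∧ δ ≤ s + t} = choppedTriangle a b δ := by
  ext x
  simp only [mem_inter_iff, mem_choppedTriangle, mem_ofPred_eq]
  constructor
  · rintro ⟨hx, s, t, rfl, hst⟩
    simp at hx ⊢
    grind
  · rintro hx
    refine ⟨by grind, 1 - x 0 - x 1, x 0, ?_, by grind⟩
    ext i
    fin_cases i <;> simp
    ring

theorem two_coords_tight {x y : ℝ} (ha : 0 ≤ a) (hb : 0 ≤ b) (hc : 0 ≤ c) (hab : a + b < 1)
    (hac : a + c < 1) (hbc : b + c < 1) (h1 : 0 ≤ x) (h2 : x ≤ 1 - b) (h3 : 0 ≤ y)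
    (h4 : y ≤ 1 - c) (h5 : a ≤ x + y) (h6 : x + y ≤ 1)
    (hxs : ¬ ((0 < x ∧ x < 1 - b) ∧ a < x + y ∧ x + y < 1))
    (hys : ¬ ((0 < y ∧ y < 1 - c) ∧ a < x + y ∧ x + y < 1))
    (hxy : ¬ ((0 < x ∧ x < 1 - b) ∧ 0 < y ∧ y < 1 - c)) :
    (x = a ∧ y = 0) ∨ (x = 0 ∧ y = a) ∨ (x = 1 - b ∧ y = 0) ∨ (x = 1 - b ∧ y = b) ∨
      (x = 0 ∧ y = 1 - c) ∨ (x = c ∧ y = 1 - c) := by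
  have strict : ∀ {r s z : ℝ}, r ≤ z → z ≤ s → ¬ (r < z ∧ z < s) → z = r ∨ z = s := by
    intro r s z hr hs h
    rcases hr.eq_or_lt' with h' | h'
    · exact Or.inl h'
    · exact Or.inr (hs.eq_of_not_lt fun h'' => h ⟨h', h''⟩)
  by_cases hx : 0 < x ∧ x < 1 - b
  · rcases strict h3 h4 fun hy => hxy ⟨hx, hy⟩ with rfl | rfl <;>
      rcases strict h5 h6 fun hs => hxs ⟨hx, hs⟩ with h | h <;> grind
  · by_cases hy : 0 < y ∧ y < 1 - c
    · rcases strict h1 h2 hx with rfl | rfl <;>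
        rcases strict h5 h6 fun hs => hys ⟨hy, hs⟩ with h | h <;> grind
    · rcases strict h1 h2 hx with rfl | rfl <;> rcases strict h3 h4 hy with rfl | rfl <;> grind

theorem coords_of_mem_extremePoints {v : Pt 2} (ha : 0 ≤ a) (hb : 0 ≤ b) (hc : 0 ≤ c) (hab : a + b < 1)
    (hac : a + c < 1) (hbc : b + c < 1) (hv : v ∈ (choppedTriangle a b c).extremePoints ℝ) :
    v = ![a, 0] ∨ v = ![0, a] ∨ v = ![1 - b, 0] ∨ v = ![1 - b, b] ∨ v = ![0, 1 - c] ∨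
      v = ![c, 1 - c] := by
  have hmem := hv.1
  obtain ⟨⟨h1, h2⟩, ⟨h3, h4⟩, h5, h6⟩ := hmem
  have perturb : ∀ d₀ d₁ : ℝ, (d₀ ≠ 0 ∨ d₁ ≠ 0) → ¬ (v + ![d₀, d₁] ∈ choppedTriangle a b c ∧
      v - ![d₀, d₁] ∈ choppedTriangle a b c) := by
    rintro d₀ d₁ hd ⟨k1, k2⟩
    have h0 := eq_zero_of_mem_extremePoints hv k1 k2
    have e0 := congrFun h0 0
    have e1 := congrFun h0 1
    simp at e0 e1
    tauto
  have pos_le : ∀ r s t u : ℝ, 0 < r → 0 < s → 0 < t → 0 < u →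
      ∃ k : ℝ, 0 < k ∧ k ≤ r ∧ k ≤ s ∧ k ≤ t ∧ k ≤ u := fun r s t u hr hs ht hu =>
    ⟨min (min r s) (min t u), by positivity, by simp, by simp, by simp, by simp⟩
  simp only [mem_choppedTriangle, Pi.add_apply, Pi.sub_apply, Matrix.cons_val_zero,
    Matrix.cons_val_one] at perturb
  have hext : ∀ r s : ℝ, v = ![r, s] ↔ v 0 = r ∧ v 1 = s := fun r s => by
    rw [funext_iff, Fin.forall_fin_two]
    rfl
  simp only [hext]
  clear hext hv
  generalize v 0 = x at *
  generalize v 1 = y at *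
  have hxs : ¬ ((0 < x ∧ x < 1 - b) ∧ a < x + y ∧ x + y < 1) := by
    rintro ⟨⟨k1, k2⟩, k3, k4⟩
    obtain ⟨k, hk, hk1, hk2, hk3, hk4⟩ := pos_le _ _ _ _ k1 (sub_pos.2 k2) (sub_pos.2 k3)
      (sub_pos.2 k4)
    refine perturb k 0 (Or.inl hk.ne') ?_
    refine ⟨⟨⟨?_, ?_⟩, ⟨?_, ?_⟩, ?_, ?_⟩, ⟨?_, ?_⟩, ⟨?_, ?_⟩, ?_, ?_⟩ <;> linarith
  have hys : ¬ ((0 < y ∧ y < 1 - c) ∧ a < x + y ∧ x + y < 1) := by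
    rintro ⟨⟨k1, k2⟩, k3, k4⟩
    obtain ⟨k, hk, hk1, hk2, hk3, hk4⟩ := pos_le _ _ _ _ k1 (sub_pos.2 k2) (sub_pos.2 k3)
      (sub_pos.2 k4)
    refine perturb 0 k (Or.inr hk.ne') ?_
    refine ⟨⟨⟨?_, ?_⟩, ⟨?_, ?_⟩, ?_, ?_⟩, ⟨?_, ?_⟩, ⟨?_, ?_⟩, ?_, ?_⟩ <;> linarith
  have hxy : ¬ ((0 < x ∧ x < 1 - b) ∧ 0 < y ∧ y < 1 - c) := by
    rintro ⟨⟨k1, k2⟩, k3, k4⟩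
    obtain ⟨k, hk, hk1, hk2, hk3, hk4⟩ := pos_le _ _ _ _ k1 (sub_pos.2 k2) k3 (sub_pos.2 k4)
    refine perturb k (-k) (Or.inl hk.ne') ?_
    refine ⟨⟨⟨?_, ?_⟩, ⟨?_, ?_⟩, ?_, ?_⟩, ⟨?_, ?_⟩, ⟨?_, ?_⟩, ?_, ?_⟩ <;> linarith
  exact two_coords_tight ha hb hc hab hac hbc h1 h2 h3 h4 h5 h6 hxs hys hxy

/-- Every vertex of a chopped triangle is either an uncut corner of the triangle or an endpoint of
one of the cuts. -/
theorem corner_cases {v : Pt 2} (ha : 0 ≤ a) (hb : 0 ≤ b) (hc : 0 ≤ c) (hab : a + b < 1)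
    (hac : a + c < 1) (hbc : b + c < 1) (hv : v ∈ (choppedTriangle a b c).extremePoints ℝ) :
    (a = 0 ∧ v = ![0, 0]) ∨ (b = 0 ∧ v = ![1, 0]) ∨ (c = 0 ∧ v = ![0, 1]) ∨
      ∃ p q l m, HasDelzantCorner (choppedTriangle a b c) v p q l m ∧ (m = a ∨ m = b ∨ m = c) := by
  rcases coords_of_mem_extremePoints ha hb hc hab hac hbc hv with rfl | rfl | rfl | rfl | rfl | rfl
  · rcases ha.eq_or_lt' with rfl | ha
    · exact Or.inl ⟨rfl, rfl⟩
    · exact Or.inr (Or.inr (Or.inr ⟨_, _, _, _,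
        hasDelzantCorner_origin_right ha hb hab hac, by simp⟩))
  · rcases ha.eq_or_lt' with rfl | ha
    · exact Or.inl ⟨rfl, rfl⟩
    · exact Or.inr (Or.inr (Or.inr ⟨_, _, _, _,
        (hasDelzantCorner_origin_top ha hb hc hab hac).symm, by simp⟩))
  · rcases hb.eq_or_lt' with rfl | hb
    · exact Or.inr (Or.inl (by simp))
    · exact Or.inr (Or.inr (Or.inr ⟨_, _, _, _,
        (hasDelzantCorner_right_origin ha hb hab hbc).symm, by simp⟩))
  · rcases hb.eq_or_lt' with rfl | hb
    · exact Or.inr (Or.inl (by simp))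
    · exact Or.inr (Or.inr (Or.inr ⟨_, _, _, _,
        hasDelzantCorner_right_top ha hb hc hab hbc, by simp⟩))
  · rcases hc.eq_or_lt' with rfl | hc
    · exact Or.inr (Or.inr (Or.inl (by simp)))
    · exact Or.inr (Or.inr (Or.inr ⟨_, _, _, _,
        hasDelzantCorner_top_origin ha hc hac hbc, by simp⟩))
  · rcases hc.eq_or_lt' with rfl | hc
    · exact Or.inr (Or.inr (Or.inl (by simp)))
    · exact Or.inr (Or.inr (Or.inr ⟨_, _, _, _,
        (hasDelzantCorner_top_right ha hb hc hac hbc).symm, by simp⟩))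

theorem isDelzant_choppedTriangle (ha : 0 ≤ a) (hb : 0 ≤ b) (hc : 0 ≤ c) (ha' : a < 1 / 2)
    (hb' : b < 1 / 2) (hc' : c < 1 / 2) : IsDelzant (choppedTriangle a b c) := by
  have hab : a + b < 1 := by linarith
  have hac : a + c < 1 := by linarith
  have hbc : b + c < 1 := by linarith
  refine ⟨⟨isCompact_choppedTriangle hb hc, convex_choppedTriangle a b c,
    interior_choppedTriangle_nonempty (by linarith) (by linarith) (by linarith), ?_⟩, ?_⟩
  · refine Set.Finite.subset (s := {![a, 0], ![0, a], ![1 - b, 0], ![1 - b, b], ![0, 1 - c],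
      ![c, 1 - c]}) (by simp) fun v hv => ?_
    simpa using coords_of_mem_extremePoints ha hb hc hab hac hbc hv
  · intro v hv
    rcases corner_cases ha hb hc hab hac hbc hv with
      ⟨rfl, rfl⟩ | ⟨rfl, rfl⟩ | ⟨rfl, rfl⟩ | ⟨p, q, l, m, h, -⟩
    · exact (hasDelzantCorner_origin hb hc (by linarith) (by linarith)).delzantAt
    · exact (hasDelzantCorner_right ha hc (by linarith) (by linarith)).delzantAt
    · exact (hasDelzantCorner_top ha hb (by linarith) (by linarith)).delzantAt
    · exact h.delzantAt

/-- A chopping of a chopped triangle either cuts an uncut corner or is smaller than an earlier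
cut. -/
theorem chop_cases {v : Pt 2} {Δ : Set (Pt 2)} (ha : 0 ≤ a) (hb : 0 ≤ b) (hc : 0 ≤ c)
    (hab : a + b < 1) (hac : a + c < 1) (hbc : b + c < 1)
    (h : IsCornerChop (choppedTriangle a b c) v δ Δ) :
    (a = 0 ∧ δ < 1 - b ∧ δ < 1 - c ∧ Δ = choppedTriangle δ b c) ∨
    (b = 0 ∧ δ < 1 - c ∧ δ < 1 - a ∧ Δ = choppedTriangle a δ c) ∨
    (c = 0 ∧ δ < 1 - a ∧ δ < 1 - b ∧ Δ = choppedTriangle a b δ) ∨ δ < a ∨ δ < b ∨ δ < c := by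
  have hδ := h.2.1.le
  rcases corner_cases ha hb hc hab hac hbc h.1 with
    ⟨rfl, rfl⟩ | ⟨rfl, rfl⟩ | ⟨rfl, rfl⟩ | ⟨p, q, l, m, hcor, hm⟩
  · have := (hasDelzantCorner_origin hb hc (by linarith) (by linarith)).of_isCornerChop h
    rw [chop_origin hδ] at this
    exact Or.inl ⟨rfl, this⟩
  · have := (hasDelzantCorner_right ha hc (by linarith) (by linarith)).of_isCornerChop h
    rw [chop_right hδ] at this
    exact Or.inr (Or.inl ⟨rfl, this⟩)
  · have := (hasDelzantCorner_top ha hb (by linarith) (by linarith)).of_isCornerChop h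
    rw [chop_top] at this
    exact Or.inr (Or.inr (Or.inl ⟨rfl, this⟩))
  · have := (hcor.of_isCornerChop h).2.1
    rcases hm with rfl | rfl | rfl <;> tauto

end corners

/-- For `m = 2` or `m = 3`, there is a sequence of `m` successive corner choppings of
equal size `ε > 0` starting from the Delzant triangle of size 1 if and only if
`ε < 1/2`. -/
theorem stmt10 (ε : ℝ) (hε : 0 < ε) (m : ℕ) (hm : m = 2 ∨ m = 3) :
    (∃ Δ : ℕ → Set (Pt 2), Δ 0 = DelzantTriangle 1 ∧
      (∀ i ≤ m, IsDelzant (Δ i)) ∧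
      ∀ i < m, ∃ w, IsCornerChop (Δ i) w ε (Δ (i + 1))) ↔
    ε < 1 / 2 := by
  constructor
  · rintro ⟨Δ, hΔ₀, -, hchop⟩
    obtain ⟨v, hv⟩ := hchop 0 (by omega)
    obtain ⟨w, hw⟩ := hchop 1 (by omega)
    rw [hΔ₀, ← choppedTriangle_zero] at hv
    rcases chop_cases le_rfl le_rfl le_rfl (by simp) (by simp) (by simp) hv with
      ⟨-, h, -, hΔ⟩ | ⟨-, h, -, hΔ⟩ | ⟨-, h, -, hΔ⟩ | h | h | h
    all_goals try linarith
    all_goals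
      rw [hΔ] at hw
      rcases chop_cases (by linarith) (by linarith) (by linarith) (by linarith) (by linarith)
        (by linarith) hw with ⟨h0, h1, h2, -⟩ | ⟨h0, h1, h2, -⟩ | ⟨h0, h1, h2, -⟩ | h | h | h <;> linarith
  · intro hlt
    have hcut : ∀ i k : ℕ, 0 ≤ (if k ≤ i then ε else 0) ∧ (if k ≤ i then ε else 0) < 1 / 2 := by
      intro i k
      split_ifs
      · exact ⟨hε.le, hlt⟩
      · norm_num
    refine ⟨fun i => choppedTriangle (if 1 ≤ i then ε else 0) (if 2 ≤ i then ε else 0)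
      (if 3 ≤ i then ε else 0), by simp [choppedTriangle_zero], fun i _ =>
      isDelzant_choppedTriangle (hcut i 1).1 (hcut i 2).1 (hcut i 3).1 (hcut i 1).2 (hcut i 2).2
        (hcut i 3).2, fun i hi => ?_⟩
    have hi3 : i < 3 := by omega
    interval_cases i
    · have := (hasDelzantCorner_origin (b := 0) (c := 0) le_rfl le_rfl one_pos one_pos).isCornerChop
        hε (by linarith) (by linarith)
      rw [chop_origin hε.le] at this
      exact ⟨_, by simpa using this⟩
    · have := (hasDelzantCorner_right (a := ε) (c := 0) hε.le le_rfl (by linarith)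
        one_pos).isCornerChop hε (by linarith) (by linarith)
      rw [chop_right hε.le] at this
      exact ⟨_, by simpa using this⟩
    · have := (hasDelzantCorner_top hε.le hε.le (by linarith) (by linarith)).isCornerChop
        hε (by linarith) (by linarith)
      rw [chop_top] at this
      exact ⟨_, by simpa using this⟩
end

section
/- For every real ε with 1/2 < ε < 1, the Hirzebruch trapezoids Hirz_{(1+ε)/2, 1−ε, 1} and Hirz_{(1+ε)/2, 1−ε, 3} are not AGL(2,ℤ)-congruent. -/
open Set Finset MeasureTheory

/-- For `1/2 < ε < 1`, the Hirzebruch trapezoids `Hirz_{(1+ε)/2, 1-ε, 1}` and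
`Hirz_{(1+ε)/2, 1-ε, 3}` are not AGL(2,ℤ)-congruent. -/
theorem stmt13 (ε : ℝ) (h1 : 1 / 2 < ε) (h2 : ε < 1) :
    ¬ AGLCongruent (Hirz ((1 + ε) / 2) (1 - ε) 1) (Hirz ((1 + ε) / 2) (1 - ε) 3) := by
  rintro ⟨g, ⟨A, c, hA, hg⟩, himg⟩
  have hp : (![0, -((1 - ε) / 2)] : Pt 2) ∈ Hirz ((1 + ε) / 2) (1 - ε) 3 := by
    simp only [Hirz, Set.mem_ofPred_eq, Matrix.cons_val_zero, Matrix.cons_val_one, Nat.cast_ofNat]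
    refine ⟨?_, ?_, ?_, ?_⟩ <;> linarith
  have hq : (![2 - ε, -((1 - ε) / 2)] : Pt 2) ∈ Hirz ((1 + ε) / 2) (1 - ε) 3 := by
    simp only [Hirz, Set.mem_ofPred_eq, Matrix.cons_val_zero, Matrix.cons_val_one, Nat.cast_ofNat]
    refine ⟨?_, ?_, ?_, ?_⟩ <;> linarith
  rw [← himg] at hp hq
  obtain ⟨x, ⟨hx1, hx2, hx3, hx4⟩, hxp⟩ := hp
  obtain ⟨y, ⟨hy1, hy2, hy3, hy4⟩, hyq⟩ := hq
  rw [hg] at hxp hyq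
  have hx0' := congrFun hxp 0
  have hx1' := congrFun hxp 1
  have hy0' := congrFun hyq 0
  have hy1' := congrFun hyq 1
  simp at hx0' hx1' hy0' hy1'
  push_cast at hx4 hy4
  rw [Matrix.det_fin_two, Int.isUnit_iff] at hA
  -- The bottom edge of the target pulls back to a chord of integral direction.
  have hd0 : ((A 0 0 * A 1 1 - A 0 1 * A 1 0 : ℤ) : ℝ) * (y 0 - x 0) = A 1 1 * (2 - ε) := by
    push_cast
    linear_combination (A 1 1 : ℝ) * (hy0' - hx0') - (A 0 1 : ℝ) * (hy1' - hx1')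
  have hd1 : ((A 0 0 * A 1 1 - A 0 1 * A 1 0 : ℤ) : ℝ) * (y 1 - x 1) = -A 1 0 * (2 - ε) := by
    push_cast
    linear_combination (A 0 0 : ℝ) * (hy1' - hx1') - (A 1 0 : ℝ) * (hy0' - hx0')
  have hdet : ((A 0 0 * A 1 1 - A 0 1 * A 1 0 : ℤ) : ℝ) = 1 ∨
      ((A 0 0 * A 1 1 - A 0 1 * A 1 0 : ℤ) : ℝ) = -1 := by
    exact_mod_cast hA
  have h10 : A 1 0 = 0 := by
    have hlt : (A 1 0 : ℝ) < 1 := by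
      rcases hdet with h | h <;> rw [h] at hd1 <;> nlinarith
    have hgt : (-1 : ℝ) < A 1 0 := by
      rcases hdet with h | h <;> rw [h] at hd1 <;> nlinarith
    have hlt' : A 1 0 < 1 := by exact_mod_cast hlt
    have hgt' : -1 < A 1 0 := by exact_mod_cast hgt
    omega
  have h11 : A 1 1 = 0 := by
    have hlt : (A 1 1 : ℝ) < 1 := by
      rcases hdet with h | h <;> rw [h] at hd0 <;> nlinarith
    have hgt : (-1 : ℝ) < A 1 1 := by
      rcases hdet with h | h <;> rw [h] at hd0 <;> nlinarith
    have hlt' : A 1 1 < 1 := by exact_mod_cast hlt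
    have hgt' : -1 < A 1 1 := by exact_mod_cast hgt
    omega
  simp [h10, h11] at hA
end
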